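/- Let E₀ > 0, α > 0 and σ̂₁ ∈ C(Ḡ, C^α(I²)). Define, for ψ, v : Ḡ×S×I → ℝ continuous and α-Hölder in (ω,E) uniformly in x, (A₁ψ)(x,ω,E) := p.f.∫_E^{E_m} (1/(E'−E))·σ̂₁(x,E',E)·( ∫_0^{2π} ψ(x, γ(E',E,ω)(s), E') ds ) dE' and (A₁*v)(x,ω',E') := p.f.∫_{E₀}^{E'} (1/(E'−E))·σ̂₁(x,E',E)·( ∫_0^{2π} v(x, γ(E',E,ω')(s), E) ds ) dE. Then all finite parts exist, A₁ψ and A₁*v are integrable, and ⟨A₁ψ, v⟩_{L²(G×S×I)} = ⟨ψ, A₁*v⟩_{L²(G×S×I)}, i.e. ∫_{G×S×I} (A₁ψ)·v dx dω dE = ∫_{G×S×I} ψ·(A₁*v) dx dω dE. -/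

import Mathlib

open MeasureTheory Filter Set Metric
open scoped Topology Real

noncomputable section

abbrev E3 : Type := EuclideanSpace ℝ (Fin 3)

/-- The surface measure on the unit sphere `S² ⊂ ℝ³`, viewed as a measure on `ℝ³`. -/
def nuS : Measure E3 := ((volume : Measure E3).toSphere).map Subtype.val

/-- The vector `(a,b,c) ∈ ℝ³` as an element of `EuclideanSpace ℝ (Fin 3)`. -/
def vec3 (a b c : ℝ) : E3 := (EuclideanSpace.equiv (Fin 3) ℝ).symm ![a, b, c]

/-- The third standard basis vector `e₃`. -/
def e₃ : E3 := EuclideanSpace.single 2 1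

/-- `μ(E',E) = √( E(E'+2) / (E'(E+2)) )`. -/
def mu (E' E : ℝ) : ℝ := Real.sqrt (E * (E' + 2) / (E' * (E + 2)))

/-- The parametrization `γ(E',E,ω)(s)` of the circle `{ω' ∈ S : ω'·ω = μ(E',E)}`. -/
def gam (R : E3 → (E3 ≃ₗᵢ[ℝ] E3)) (E' E : ℝ) (ω : E3) (s : ℝ) : E3 :=
  R ω (vec3 (Real.sqrt (1 - mu E' E ^ 2) * Real.cos s)
        (Real.sqrt (1 - mu E' E ^ 2) * Real.sin s) (mu E' E))

/-- Hadamard finite part of order 1 with upper limit `b`. -/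
def HasPF1Upper (g : ℝ → ℝ) (x b L : ℝ) : Prop :=
  Tendsto (fun ε : ℝ => (∫ t in (x + ε)..b, g t / (t - x)) + g x * Real.log ε)
    (𝓝[>] (0 : ℝ)) (𝓝 L)

/-- Hadamard finite part of order 1 with lower limit `a`. -/
def HasPF1Lower (g : ℝ → ℝ) (a x L : ℝ) : Prop :=
  Tendsto (fun ε : ℝ => (∫ t in a..(x - ε), g t / (x - t)) + g x * Real.log ε)
    (𝓝[>] (0 : ℝ)) (𝓝 L)

/-- The orthogonal group of `ℝ³`, as a topological group. -/
abbrev OrthE3 : Type := unitary (E3 →L[ℝ] E3)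

instance : ContinuousStar (E3 →L[ℝ] E3) :=
  ⟨(ContinuousLinearMap.adjoint (𝕜 := ℝ) (E := E3) (F := E3)).continuous⟩

instance : ProperSpace (E3 →L[ℝ] E3) := FiniteDimensional.proper ℝ _

instance : CompactSpace OrthE3 := by
  refine isCompact_iff_compactSpace.mp (isCompact_of_isClosed_isBounded isClosed_unitary ?_)
  refine (Metric.isBounded_closedBall (x := (0 : E3 →L[ℝ] E3)) (r := 1)).subset fun u hu => ?_
  rw [mem_closedBall_zero_iff]
  exact ContinuousLinearMap.opNorm_le_bound _ zero_le_one fun x => by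
    rw [one_mul]
    exact (congrArg (fun z => z ≤ ‖x‖)
      ((Unitary.linearIsometryEquiv (𝕜 := ℝ) ⟨u, hu⟩).norm_map x)).mpr le_rfl

lemma exists_rightInvariant_probability_orthE3 :
    ∃ κ : Measure OrthE3, IsProbabilityMeasure κ ∧ κ.IsMulRightInvariant := by
  let κ₀ : Measure OrthE3 := Measure.haarMeasure ⊤
  refine ⟨κ₀.inv, ⟨?_⟩, inferInstance⟩
  rw [Measure.inv_apply, Set.inv_univ]
  simpa using Measure.haarMeasure_self (K₀ := (⊤ : TopologicalSpace.PositiveCompacts OrthE3))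

lemma continuous_orthE3_apply {X : Type*} [TopologicalSpace X] {k : X → OrthE3} {w : X → E3}
    (hk : Continuous k) (hw : Continuous w) :
    Continuous fun x => (k x : E3 →L[ℝ] E3) (w x) :=
  (continuous_subtype_val.comp hk).clm_apply hw

/-- The orthogonal transformation underlying a linear isometry. -/
def toOrthE3 (T : E3 ≃ₗᵢ[ℝ] E3) : OrthE3 := (Unitary.linearIsometryEquiv (𝕜 := ℝ)).symm T

lemma toOrthE3_apply (T : E3 ≃ₗᵢ[ℝ] E3) (x : E3) : (toOrthE3 T : E3 →L[ℝ] E3) x = T x := rfl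

lemma exists_isometry_swap {p q : E3} (h : ‖p‖ = ‖q‖) :
    ∃ T : E3 ≃ₗᵢ[ℝ] E3, T p = q ∧ T q = p := by
  refine ⟨Submodule.reflection (ℝ ∙ (p - q))ᗮ, Submodule.reflection_sub h, ?_⟩
  have h1 := Submodule.reflection_sub h
  have h2 := Submodule.reflection_reflection (ℝ ∙ (p - q))ᗮ p
  rwa [h1] at h2

lemma norm_e₃ : ‖e₃‖ = 1 := by simp [e₃]

instance : IsFiniteMeasure nuS := by unfold nuS; infer_instance

lemma ae_mem_sphere_nuS : ∀ᵐ ω ∂nuS, ω ∈ sphere (0 : E3) 1 := by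
  unfold nuS
  rw [ae_map_iff (p := fun ω => ω ∈ sphere (0 : E3) 1) measurable_subtype_coe.aemeasurable
    isClosed_sphere.measurableSet]
  exact Eventually.of_forall fun x => x.2

open scoped Pointwise in
lemma nuS_apply {s : Set E3} (hs : MeasurableSet s) :
    nuS s = 3 * volume (Ioo (0 : ℝ) 1 • (s ∩ sphere (0 : E3) 1)) := by
  unfold nuS
  rw [Measure.map_apply measurable_subtype_coe hs,
    Measure.toSphere_apply' _ (measurable_subtype_coe hs)]
  rw [Subtype.image_preimage_coe, inter_comm]
  simp

open scoped Pointwise in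
lemma measurePreserving_nuS (T : E3 ≃ₗᵢ[ℝ] E3) : MeasurePreserving T nuS nuS := by
  refine ⟨T.continuous.measurable, ?_⟩
  ext s hs
  rw [Measure.map_apply T.continuous.measurable hs, nuS_apply hs,
    nuS_apply (T.continuous.measurable hs)]
  congr 1
  refine Eq.trans (congrArg volume ?_) (T.measurePreserving.measure_preimage_equiv
    (f := T.toHomeomorph.toMeasurableEquiv) (Ioo (0 : ℝ) 1 • (s ∩ sphere (0 : E3) 1)))
  ext x
  have hx : x ∈ T.toHomeomorph.toMeasurableEquiv ⁻¹' (Ioo (0 : ℝ) 1 • (s ∩ sphere (0 : E3) 1))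
    ↔ T x ∈ Ioo (0 : ℝ) 1 • (s ∩ sphere (0 : E3) 1) := Iff.rfl
  rw [hx]
  simp only [Set.mem_smul, mem_preimage, mem_inter_iff, mem_sphere_zero_iff_norm]
  constructor
  · rintro ⟨r, hr, y, ⟨hy, hy1⟩, rfl⟩
    exact ⟨r, hr, T y, ⟨hy, by simpa using hy1⟩, by simp⟩
  · rintro ⟨r, hr, y, ⟨hy, hy1⟩, hxy⟩
    refine ⟨r, hr, T.symm y, ⟨by simpa using hy, by simpa using hy1⟩, ?_⟩
    apply T.injective
    simpa using hxy

lemma integrable_of_bounded {X : Type*} [MeasurableSpace X] {m : Measure X} [IsFiniteMeasure m]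
    {f : X → ℝ} (hf : Measurable f) {C : ℝ} (hC : ∀ x, |f x| ≤ C) : Integrable f m :=
  Integrable.of_bound hf.aestronglyMeasurable C (Eventually.of_forall hC)

lemma integral_nuS_eq (κ : Measure OrthE3) [IsProbabilityMeasure κ] [κ.IsMulRightInvariant]
    {F : E3 → ℝ} (hF : Measurable F) {C : ℝ} (hC : ∀ x, |F x| ≤ C) :
    ∫ ω, F ω ∂nuS = nuS.real univ * ∫ k, F ((k : E3 →L[ℝ] E3) e₃) ∂κ := by
  have h1 : ∀ k : OrthE3, ∫ ω, F ((k : E3 →L[ℝ] E3) ω) ∂nuS = ∫ ω, F ω ∂nuS := fun k =>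
    (measurePreserving_nuS (Unitary.linearIsometryEquiv (𝕜 := ℝ) k)).integral_comp
      (Unitary.linearIsometryEquiv (𝕜 := ℝ) k).toHomeomorph.measurableEmbedding F
  have h2 : ∀ ω ∈ sphere (0 : E3) 1, ∫ k, F ((k : E3 →L[ℝ] E3) ω) ∂κ
      = ∫ k, F ((k : E3 →L[ℝ] E3) e₃) ∂κ := by
    intro ω hω
    obtain ⟨T, hT, -⟩ := exists_isometry_swap (p := e₃) (q := ω)
      (by rw [norm_e₃, mem_sphere_zero_iff_norm.mp hω])
    rw [← integral_mul_right_eq_self (μ := κ) (fun k => F ((k : E3 →L[ℝ] E3) e₃)) (toOrthE3 T)]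
    refine integral_congr_ae (Eventually.of_forall fun k => ?_)
    simp only [Submonoid.coe_mul, mul_apply_eq_comp, toOrthE3_apply, hT]
  have hm : Measurable (fun z : E3 × OrthE3 => F ((z.2 : E3 →L[ℝ] E3) z.1)) :=
    hF.comp (continuous_orthE3_apply continuous_snd continuous_fst).measurable
  have h3 := integral_integral_swap (μ := nuS) (ν := κ)
    (f := fun ω k => F ((k : E3 →L[ℝ] E3) ω)) (integrable_of_bounded hm fun z => hC _)
  simp only [h1] at h3
  rw [integral_congr_ae (ae_mem_sphere_nuS.mono h2)] at h3
  simpa using h3.symm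

/-- The circle at height `d` and radius `c` around the third axis. -/
def circ (c d s : ℝ) : E3 := vec3 (c * Real.cos s) (c * Real.sin s) d

lemma continuous_circ (c d : ℝ) : Continuous (circ c d) := by
  unfold circ vec3
  refine (EuclideanSpace.equiv (Fin 3) ℝ).symm.continuous.comp ?_
  refine continuous_pi fun i => ?_
  fin_cases i <;> simp <;> fun_prop

lemma norm_circ {c d : ℝ} (h : c ^ 2 + d ^ 2 = 1) (s : ℝ) : ‖circ c d s‖ = 1 := by
  rw [EuclideanSpace.norm_eq, Real.sqrt_eq_one]
  simp [circ, vec3, Fin.sum_univ_three]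
  nlinarith [Real.sin_sq_add_cos_sq s]

lemma exists_angle_of_fix_e₃ (T : E3 ≃ₗᵢ[ℝ] E3) (hT : T e₃ = e₃) :
    ∃ θ σ : ℝ, (σ = 1 ∨ σ = -1) ∧ ∀ c d s, T (circ c d s) = circ c d (θ + σ * s) := by
  set a := T (EuclideanSpace.single 0 1) with ha
  set b := T (EuclideanSpace.single 1 1) with hb
  have hin : ∀ x y : E3, inner ℝ (T x) (T y) = inner ℝ x y := T.inner_map_map
  have e1 : a 2 = 0 := by
    have := hin (EuclideanSpace.single 0 1) e₃
    rw [hT] at this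
    simpa [e₃, ← ha, EuclideanSpace.inner_single_right] using this
  have e2 : b 2 = 0 := by
    have := hin (EuclideanSpace.single 1 1) e₃
    rw [hT] at this
    simpa [e₃, ← hb, EuclideanSpace.inner_single_right] using this
  have e3 : a 0 * a 0 + a 1 * a 1 = 1 := by
    have := hin (EuclideanSpace.single 0 1) (EuclideanSpace.single 0 1)
    rw [← ha, PiLp.inner_apply, Fin.sum_univ_three, e1] at this
    simpa [sq] using this
  have e4 : b 0 * b 0 + b 1 * b 1 = 1 := by
    have := hin (EuclideanSpace.single 1 1) (EuclideanSpace.single 1 1)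
    rw [← hb, PiLp.inner_apply, Fin.sum_univ_three, e2] at this
    simpa [sq] using this
  have e5 : b 0 * a 0 + b 1 * a 1 = 0 := by
    have := hin (EuclideanSpace.single 0 1) (EuclideanSpace.single 1 1)
    rw [← hb, ← ha, PiLp.inner_apply, Fin.sum_univ_three, e2] at this
    simpa [EuclideanSpace.inner_single_right] using this
  obtain ⟨θ, hc, hs⟩ : ∃ θ : ℝ, Real.cos θ = a 0 ∧ Real.sin θ = a 1 := by
    have hn : ‖(⟨a 0, a 1⟩ : ℂ)‖ = 1 := by
      rw [← sq_eq_sq₀ (norm_nonneg _) zero_le_one, Complex.sq_norm, Complex.normSq_mk]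
      linarith
    have h0 : (⟨a 0, a 1⟩ : ℂ) ≠ 0 := fun h => by simp [h] at hn
    exact ⟨Complex.arg ⟨a 0, a 1⟩, by rw [Complex.cos_arg h0, hn, div_one],
      by rw [Complex.sin_arg, hn, div_one]⟩
  have hσ : (a 0 * b 1 - a 1 * b 0 - 1) * (a 0 * b 1 - a 1 * b 0 + 1) = 0 := by
    linear_combination (b 0 * b 0 + b 1 * b 1) * e3 + e4 - (b 0 * a 0 + b 1 * a 1) * e5
  have hb0 : b 0 = -(a 0 * b 1 - a 1 * b 0) * a 1 := by
    linear_combination -b 0 * e3 + a 0 * e5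
  have hb1 : b 1 = (a 0 * b 1 - a 1 * b 0) * a 0 := by
    linear_combination -b 1 * e3 + a 1 * e5
  have hdec : ∀ c d s, circ c d s = (c * Real.cos s) • EuclideanSpace.single 0 (1 : ℝ)
      + (c * Real.sin s) • EuclideanSpace.single 1 (1 : ℝ) + d • e₃ := by
    intro c d s
    ext i
    fin_cases i <;> simp [circ, vec3, e₃]
  have hTc : ∀ c d s, T (circ c d s) = (c * Real.cos s) • a + (c * Real.sin s) • b + d • e₃ := by
    intro c d s
    rw [hdec, map_add, map_add, map_smul, map_smul, map_smul, hT]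
  refine ⟨θ, a 0 * b 1 - a 1 * b 0, ?_, fun c d s => ?_⟩
  · rcases mul_eq_zero.mp hσ with h | h
    · exact Or.inl (by linarith)
    · exact Or.inr (by linarith)
  · rw [hTc]
    generalize a 0 * b 1 - a 1 * b 0 = σ at *
    have hσ' : σ = 1 ∨ σ = -1 := by
      rcases mul_eq_zero.mp hσ with h | h
      · exact Or.inl (by linarith)
      · exact Or.inr (by linarith)
    have hcs : Real.cos (σ * s) = Real.cos s ∧ Real.sin (σ * s) = σ * Real.sin s := by
      rcases hσ' with rfl | rfl <;> simp
    ext i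
    fin_cases i
    · simp [circ, vec3, e₃, Real.cos_add, hcs.1, hcs.2, hc, hs, hb0]
      ring
    · simp [circ, vec3, e₃, Real.sin_add, hcs.1, hcs.2, hc, hs, hb1]
      ring
    · simp [circ, vec3, e₃, e1, e2]

lemma integral_circ_fix_e₃ (T : E3 ≃ₗᵢ[ℝ] E3) (hT : T e₃ = e₃) (h : E3 → ℝ) (c d : ℝ) :
    ∫ s in (0 : ℝ)..(2 * π), h (T (circ c d s)) = ∫ s in (0 : ℝ)..(2 * π), h (circ c d s) := by
  obtain ⟨θ, σ, hσ, hTc⟩ := exists_angle_of_fix_e₃ T hT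
  have hper : Function.Periodic (fun s => h (circ c d s)) (2 * π) := fun s => by
    simp [circ]
  simp only [hTc]
  rcases hσ with rfl | rfl
  · simp only [one_mul]
    rw [intervalIntegral.integral_comp_add_left (fun s => h (circ c d s)) θ]
    have := hper.intervalIntegral_add_eq θ 0
    simpa using this
  · simp only [neg_one_mul, ← sub_eq_add_neg]
    rw [intervalIntegral.integral_comp_sub_left (fun s => h (circ c d s)) θ]
    have := hper.intervalIntegral_add_eq (θ - 2 * π) 0
    simpa using this

lemma measurable_frame {R : E3 → (E3 ≃ₗᵢ[ℝ] E3)} (hRm : ∀ w : E3, Measurable fun ω => R ω w) :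
    Measurable fun z : E3 × E3 => R z.1 z.2 := by
  have h : (fun z : E3 × E3 => R z.1 z.2)
      = fun z => ∑ i, z.2 i • R z.1 (EuclideanSpace.single i (1 : ℝ)) := by
    funext z
    conv_lhs => rw [← (EuclideanSpace.basisFun (Fin 3) ℝ).sum_repr z.2]
    simp
  rw [h]
  refine Finset.measurable_sum _ fun i _ => ?_
  have h1 : Measurable fun z : E3 × E3 => z.2 i := by
    have : Continuous fun z : E3 × E3 => z.2 i := by fun_prop
    exact this.measurable
  exact h1.smul ((hRm _).comp measurable_fst)

lemma abs_intervalIntegral_two_pi_le {g : ℝ → ℝ} {C : ℝ} (hC : ∀ s, |g s| ≤ C) :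
    |∫ s in (0 : ℝ)..(2 * π), g s| ≤ C * (2 * π) := by
  have := intervalIntegral.norm_integral_le_of_norm_le_const (a := 0) (b := 2 * π) (f := g)
    (C := C) fun s _ => hC s
  simpa [abs_of_pos Real.pi_pos] using this

/-- Averaging over circles of a fixed opening angle is symmetric on `L²(S²)`. -/
lemma circle_average_symmetric {R : E3 → (E3 ≃ₗᵢ[ℝ] E3)} (hR : ∀ ω : E3, ‖ω‖ = 1 → R ω e₃ = ω)
    (hRm : ∀ w : E3, Measurable fun ω => R ω w) {f h : E3 → ℝ} (hf : Measurable f)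
    (hh : Measurable h) {Cf Ch : ℝ} (hCf : ∀ x, |f x| ≤ Cf) (hCh : ∀ x, |h x| ≤ Ch)
    {c d : ℝ} (hcd : c ^ 2 + d ^ 2 = 1) :
    ∫ ω, f ω * (∫ s in (0 : ℝ)..(2 * π), h (R ω (circ c d s))) ∂nuS
      = ∫ ω, h ω * (∫ s in (0 : ℝ)..(2 * π), f (R ω (circ c d s))) ∂nuS := by
  obtain ⟨κ, hκ1, hκ2⟩ := exists_rightInvariant_probability_orthE3
  have key : ∀ {f h : E3 → ℝ} (hf : Measurable f) (hh : Measurable h) {Cf Ch : ℝ}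
      (hCf : ∀ x, |f x| ≤ Cf) (hCh : ∀ x, |h x| ≤ Ch),
      ∫ ω, f ω * (∫ s in (0 : ℝ)..(2 * π), h (R ω (circ c d s))) ∂nuS
        = nuS.real univ * ∫ s in (0 : ℝ)..(2 * π), ∫ k : OrthE3, f ((k : E3 →L[ℝ] E3) e₃) *
          h ((k : E3 →L[ℝ] E3) (circ c d s)) ∂κ := by
    intro f h hf hh Cf Ch hCf hCh
    have hm : Measurable fun ω => ∫ s in (0 : ℝ)..(2 * π), h (R ω (circ c d s)) := by
      simp only [intervalIntegral.integral_of_le Real.two_pi_pos.le]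
      refine (StronglyMeasurable.integral_prod_right (f := fun ω s => h (R ω (circ c d s)))
        ?_).measurable
      exact (hh.comp ((measurable_frame hRm).comp (measurable_fst.prodMk
        ((continuous_circ c d).measurable.comp measurable_snd)))).stronglyMeasurable
    rw [integral_nuS_eq κ (F := fun ω => f ω * ∫ s in (0 : ℝ)..(2 * π), h (R ω (circ c d s)))
      (hf.mul hm) (C := Cf * (Ch * (2 * π)))]
    · congr 1
      rw [intervalIntegral.integral_of_le Real.two_pi_pos.le]
      have hmm : Measurable (fun z : ℝ × OrthE3 => f ((z.2 : E3 →L[ℝ] E3) e₃) *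
          h ((z.2 : E3 →L[ℝ] E3) (circ c d z.1))) :=
        (hf.comp (continuous_orthE3_apply continuous_snd continuous_const).measurable).mul
          (hh.comp (continuous_orthE3_apply continuous_snd
            ((continuous_circ c d).comp continuous_fst)).measurable)
      rw [integral_integral_swap]
      · refine integral_congr_ae (Eventually.of_forall fun k => ?_)
        simp only
        rw [integral_const_mul, ← intervalIntegral.integral_of_le Real.two_pi_pos.le]
        congr 1
        set L : E3 ≃ₗᵢ[ℝ] E3 := Unitary.linearIsometryEquiv (𝕜 := ℝ) k with hL
        have hLk : ∀ x, (k : E3 →L[ℝ] E3) x = L x := fun x => rfl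
        have hT : ((R (L e₃)).trans L.symm) e₃ = e₃ := by
          simp [hR (L e₃) (by rw [L.norm_map, norm_e₃])]
        have := integral_circ_fix_e₃ _ hT (fun x => h (L x)) c d
        simpa [hLk] using this
      · exact integrable_of_bounded hmm (C := Cf * Ch) fun z => by
          rw [Function.uncurry, abs_mul]
          exact mul_le_mul (hCf _) (hCh _) (abs_nonneg _) ((abs_nonneg _).trans (hCf 0))
    · intro x
      rw [abs_mul]
      exact mul_le_mul (hCf _) (abs_intervalIntegral_two_pi_le fun s => hCh _) (abs_nonneg _)
        ((abs_nonneg _).trans (hCf 0))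
  rw [key hf hh hCf hCh, key hh hf hCh hCf]
  congr 1
  refine intervalIntegral.integral_congr fun s _ => ?_
  obtain ⟨T, hT1, hT2⟩ := exists_isometry_swap (p := e₃) (q := circ c d s)
    (by rw [norm_e₃, norm_circ hcd])
  rw [← integral_mul_right_eq_self (μ := κ) _ (toOrthE3 T)]
  refine integral_congr_ae (Eventually.of_forall fun k => ?_)
  simp only [Submonoid.coe_mul, mul_apply_eq_comp, toOrthE3_apply, hT1, hT2]
  ring

lemma integrableOn_abs_rpow {β : ℝ} (hβ : 0 < β) {L : ℝ} (hL : 0 ≤ L) :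
    IntegrableOn (fun u : ℝ => |u| ^ (β - 1)) (Icc (-L) L) := by
  have h1 : IntervalIntegrable (fun u : ℝ => |u| ^ (β - 1)) volume 0 L := by
    refine (intervalIntegral.intervalIntegrable_rpow' (r := β - 1) (by linarith)).congr_uIoo ?_
    intro u hu
    rw [uIoo_of_le hL] at hu
    simp only [abs_of_pos hu.1]
  have h2 : IntervalIntegrable (fun u : ℝ => |u| ^ (β - 1)) volume (-L) 0 := by
    have := h1.symm.comp_sub_left 0
    simpa using this
  exact (intervalIntegrable_iff_integrableOn_Icc_of_le (by linarith)).mp (h2.trans h1)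

lemma integrableOn_abs_sub_rpow {β : ℝ} (hβ : 0 < β) {a b e : ℝ} (he : e ∈ Icc a b) :
    IntegrableOn (fun t : ℝ => |t - e| ^ (β - 1)) (Icc a b) ∧
      ∫ t in Icc a b, |t - e| ^ (β - 1) ≤ ∫ u in Icc (-(b - a)) (b - a), |u| ^ (β - 1) := by
  have hI := integrableOn_abs_rpow hβ (L := b - a) (by linarith [he.1, he.2])
  have hmp : MeasurePreserving (fun t : ℝ => t - e) volume volume :=
    measurePreserving_sub_right volume e
  have hemb : MeasurableEmbedding (fun t : ℝ => t - e) := measurableEmbedding_subRight e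
  have hpre : (fun t : ℝ => t - e) ⁻¹' Icc (a - e) (b - e) = Icc a b := by
    ext t; simp
  have hsub : Icc (a - e) (b - e) ⊆ Icc (-(b - a)) (b - a) :=
    Icc_subset_Icc (by linarith [he.2]) (by linarith [he.1])
  constructor
  · have := (hmp.integrableOn_comp_preimage hemb (f := fun u : ℝ => |u| ^ (β - 1))
      (s := Icc (a - e) (b - e))).mpr (hI.mono_set hsub)
    rwa [hpre] at this
  · have := hmp.setIntegral_preimage_emb hemb (fun u : ℝ => |u| ^ (β - 1)) (Icc (a - e) (b - e))
    rw [hpre] at this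
    rw [this]
    exact setIntegral_mono_set hI (Eventually.of_forall fun u => Real.rpow_nonneg (abs_nonneg u) _)
      hsub.eventuallyLE

/-- Hadamard finite part of `∫ g t / |t - e| dt` over the section at `e` of `T`, with the kernel
regularized by `ε`; `ℓ e` is the length of the section. -/
def pfOp (T : Set (ℝ × ℝ)) (ℓ : ℝ → ℝ) (ε : ℝ) (g : ℝ → ℝ) (e : ℝ) : ℝ :=
  (∫ t in {t | (e, t) ∈ T}, (g t - g e) / (|t - e| + ε)) + g e * Real.log (ℓ e + ε)

lemma measurable_setIntegral_section {Y : Type*} [MeasurableSpace Y] {T : Set (ℝ × ℝ)}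
    (hT : MeasurableSet T) {F : Y × ℝ → ℝ → ℝ} (hF : Measurable (Function.uncurry F)) :
    Measurable fun z : Y × ℝ => ∫ t in {t | (z.2, t) ∈ T}, F z t := by
  classical
  have : (fun z : Y × ℝ => ∫ t in {t | (z.2, t) ∈ T}, F z t)
      = fun z => ∫ t, {q : (Y × ℝ) × ℝ | (q.1.2, q.2) ∈ T}.indicator (Function.uncurry F)
    (z, t) := by
    funext z
    have hs : MeasurableSet {t | (z.2, t) ∈ T} := measurable_prodMk_left hT
    rw [← integral_indicator hs]
    rfl
  rw [this]
  have hTm : MeasurableSet {q : (Y × ℝ) × ℝ | (q.1.2, q.2) ∈ T} :=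
    ((measurable_snd.comp measurable_fst).prodMk measurable_snd) hT
  exact ((hF.indicator hTm).stronglyMeasurable.integral_prod_right').measurable

lemma measurable_pfOp {Y : Type*} [MeasurableSpace Y] {T : Set (ℝ × ℝ)}
    (hT : MeasurableSet T) {ℓ : ℝ → ℝ} (hℓ : Measurable ℓ) (ε : ℝ) {F : Y → ℝ → ℝ → ℝ}
    (hF : Measurable fun q : Y × ℝ × ℝ => F q.1 q.2.1 q.2.2) :
    Measurable fun z : Y × ℝ => pfOp T ℓ ε (F z.1 z.2) z.2 := by
  have h1 : Measurable fun z : Y × ℝ => F z.1 z.2 z.2 :=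
    hF.comp (measurable_fst.prodMk (measurable_snd.prodMk measurable_snd))
  have h2 : Measurable fun q : (Y × ℝ) × ℝ => F q.1.1 q.1.2 q.2 :=
    hF.comp (by fun_prop : Measurable fun q : (Y × ℝ) × ℝ => (q.1.1, q.1.2, q.2))
  unfold pfOp
  refine (measurable_setIntegral_section hT
    (F := fun z t => (F z.1 z.2 t - F z.1 z.2 z.2) / (|t - z.2| + ε)) ?_).add
    (h1.mul (Real.measurable_log.comp ((hℓ.comp measurable_snd).add_const ε)))
  refine (h2.sub (h1.comp measurable_fst)).div ?_
  have : Measurable fun q : (Y × ℝ) × ℝ => q.2 - q.1.2 := by fun_prop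
  exact (continuous_abs.measurable.comp this).add_const ε

lemma pfOp_const_mul (T : Set (ℝ × ℝ)) (ℓ : ℝ → ℝ) (ε a : ℝ) (g : ℝ → ℝ) (e : ℝ) :
    pfOp T ℓ ε (fun t => a * g t) e = a * pfOp T ℓ ε g e := by
  unfold pfOp
  rw [mul_add, ← integral_const_mul]
  congr 1
  · congr 1
    funext t
    ring
  · ring

lemma pfOp_integrand_bound {β : ℝ} {g : ℝ → ℝ} {C e t ε : ℝ} (hC : 0 ≤ C)
    (h : |g t - g e| ≤ C * |t - e| ^ β) (hε : 0 ≤ ε) :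
    ‖(g t - g e) / (|t - e| + ε)‖ ≤ C * |t - e| ^ (β - 1) := by
  rcases eq_or_ne t e with rfl | hne
  · simp only [sub_self, zero_div, norm_zero]
    positivity
  have hpos : 0 < |t - e| := abs_pos.mpr (sub_ne_zero.mpr hne)
  rw [Real.norm_eq_abs, abs_div, abs_of_pos (by linarith : 0 < |t - e| + ε),
    Real.rpow_sub_one hpos.ne', ← mul_div_assoc]
  exact div_le_div₀ (by positivity) h hpos (by linarith)

lemma abs_log_add_le {l L ε : ℝ} (hl : 0 < l ∨ l = 0 ∧ ε = 0) (hlL : l ≤ L) (hε : 0 ≤ ε)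
    (hε1 : ε ≤ 1) : |Real.log (l + ε)| ≤ |Real.log l| + |Real.log (L + 1)| := by
  rcases hl with hl | ⟨rfl, rfl⟩
  · have h1 : Real.log l ≤ Real.log (l + ε) := Real.log_le_log hl (by linarith)
    have h2 : Real.log (l + ε) ≤ Real.log (L + 1) := Real.log_le_log (by linarith) (by linarith)
    rw [abs_le]
    constructor
    · linarith [neg_abs_le (Real.log l), abs_nonneg (Real.log (L + 1))]
    · linarith [le_abs_self (Real.log (L + 1)), abs_nonneg (Real.log l)]
  · simp

lemma abs_pfOp_le {β : ℝ} (hβ : 0 < β) {a b : ℝ} {T : Set (ℝ × ℝ)} {ℓ g : ℝ → ℝ} {C D L e ε : ℝ}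
    (hC : 0 ≤ C) (he : e ∈ Icc a b) (hT : {t | (e, t) ∈ T} ⊆ Icc a b)
    (hTm : MeasurableSet {t | (e, t) ∈ T})
    (hg : ∀ t, (e, t) ∈ T → |g t - g e| ≤ C * |t - e| ^ β) (hD : |g e| ≤ D)
    (hl : 0 < ℓ e ∨ ℓ e = 0 ∧ ε = 0) (hlL : ℓ e ≤ L) (hε : 0 ≤ ε) (hε1 : ε ≤ 1) :
    |pfOp T ℓ ε g e| ≤ C * (∫ u in Icc (-(b - a)) (b - a), |u| ^ (β - 1))
      + D * (|Real.log (ℓ e)| + |Real.log (L + 1)|) := by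
  obtain ⟨h1, h2⟩ := integrableOn_abs_sub_rpow hβ he
  refine (abs_add_le _ _).trans (add_le_add ?_ ?_)
  · have h3 := norm_integral_le_of_norm_le (μ := volume.restrict {t | (e, t) ∈ T})
      (f := fun t => (g t - g e) / (|t - e| + ε)) ((h1.mono_set hT).const_mul C)
      ((ae_restrict_iff' hTm).mpr (Eventually.of_forall fun t ht =>
        pfOp_integrand_bound hC (hg t ht) hε))
    refine h3.trans ?_
    rw [integral_const_mul]
    refine mul_le_mul_of_nonneg_left (le_trans ?_ h2) hC
    exact setIntegral_mono_set h1 (Eventually.of_forall fun u => Real.rpow_nonneg (abs_nonneg _) _)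
      hT.eventuallyLE
  · rw [abs_mul]
    exact mul_le_mul hD (abs_log_add_le hl hlL hε hε1) (abs_nonneg _) ((abs_nonneg _).trans hD)

lemma tendsto_pfOp {β : ℝ} (hβ : 0 < β) {a b : ℝ} {T : Set (ℝ × ℝ)} {ℓ g : ℝ → ℝ} {C e : ℝ}
    (hC : 0 ≤ C) (he : e ∈ Icc a b) (hT : {t | (e, t) ∈ T} ⊆ Icc a b)
    (hTm : MeasurableSet {t | (e, t) ∈ T}) (hgm : Measurable g)
    (hg : ∀ t, (e, t) ∈ T → |g t - g e| ≤ C * |t - e| ^ β) (hl : 0 < ℓ e) :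
    Tendsto (fun ε => pfOp T ℓ ε g e) (𝓝[>] 0) (𝓝 (pfOp T ℓ 0 g e)) := by
  obtain ⟨h1, -⟩ := integrableOn_abs_sub_rpow hβ he
  unfold pfOp
  refine Tendsto.add ?_ ?_
  · refine tendsto_integral_filter_of_dominated_convergence (fun t => C * |t - e| ^ (β - 1))
      ?_ ?_ ((h1.mono_set hT).const_mul C) ?_
    · refine Eventually.of_forall fun ε => Measurable.aestronglyMeasurable ?_
      have : Measurable fun t : ℝ => |t - e| + ε := by fun_prop
      exact (hgm.sub_const _).div this
    · filter_upwards [self_mem_nhdsWithin] with ε hε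
      exact (ae_restrict_iff' hTm).mpr (Eventually.of_forall fun t ht =>
        pfOp_integrand_bound hC (hg t ht) (le_of_lt hε))
    · refine Eventually.of_forall fun t => ?_
      rcases eq_or_ne t e with rfl | hne
      · simp
      · have hc : ContinuousAt (fun ε : ℝ => (g t - g e) / (|t - e| + ε)) 0 := by
          refine ContinuousAt.div (by fun_prop) (by fun_prop) ?_
          simpa using sub_ne_zero.mpr hne
        exact hc.tendsto.mono_left nhdsWithin_le_nhds
  · have hc : ContinuousAt (fun ε : ℝ => g e * Real.log (ℓ e + ε)) 0 := by
      refine ContinuousAt.mul (by fun_prop) (ContinuousAt.log (by fun_prop) ?_)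
      simpa using hl.ne'
    exact hc.tendsto.mono_left nhdsWithin_le_nhds

lemma pfOp_eq_of_pos {a b : ℝ} {T : Set (ℝ × ℝ)} {ℓ g : ℝ → ℝ} {D e ε : ℝ}
    (hT : {t | (e, t) ∈ T} ⊆ Icc a b) (hgm : Measurable g) (hD : ∀ t, |g t| ≤ D)
    (hε : 0 < ε)
    (hl : ∫ t in {t | (e, t) ∈ T}, (|t - e| + ε)⁻¹ = Real.log (ℓ e + ε) - Real.log ε) :
    pfOp T ℓ ε g e = (∫ t in {t | (e, t) ∈ T}, g t / (|t - e| + ε)) + Real.log ε * g e := by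
  have hfin : volume {t | (e, t) ∈ T} ≠ ⊤ :=
    ((measure_mono hT).trans_lt (by simp)).ne
  have : IsFiniteMeasure (volume.restrict {t | (e, t) ∈ T}) :=
    ⟨by rw [Measure.restrict_apply_univ]; exact hfin.lt_top⟩
  have hm : Measurable fun t : ℝ => (|t - e| + ε)⁻¹ := by fun_prop
  have hb : ∀ t : ℝ, |(|t - e| + ε)⁻¹| ≤ ε⁻¹ := fun t => by
    rw [abs_of_nonneg (by positivity)]
    exact inv_anti₀ hε (by linarith [abs_nonneg (t - e)])
  have i1 : Integrable (fun t => g t * (|t - e| + ε)⁻¹) (volume.restrict {t | (e, t) ∈ T}) :=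
    integrable_of_bounded (hgm.mul hm) (C := D * ε⁻¹) fun t => by
      rw [abs_mul]
      exact mul_le_mul (hD t) (hb t) (abs_nonneg _) ((abs_nonneg _).trans (hD t))
  have i2 : Integrable (fun t => g e * (|t - e| + ε)⁻¹) (volume.restrict {t | (e, t) ∈ T}) :=
    (integrable_of_bounded hm hb).const_mul _
  unfold pfOp
  simp only [div_eq_mul_inv, sub_mul]
  rw [integral_sub i1 i2, integral_const_mul, hl]
  ring

/-- A family of sections of the square `[a,b]²`, the section at `e` being adjacent to `e` and of
length `ℓ e`. -/
structure IsSectionFamily (a b : ℝ) (T : Set (ℝ × ℝ)) (ℓ : ℝ → ℝ) : Prop where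
  measurableSet : MeasurableSet T
  subset : ∀ e ∈ Icc a b, {t | (e, t) ∈ T} ⊆ Icc a b
  measurable_len : Measurable ℓ
  len_pos : ∀ᵐ e ∂(volume.restrict (Icc a b)), 0 < ℓ e
  len_nonneg : ∀ e ∈ Icc a b, 0 ≤ ℓ e
  len_le : ∀ e ∈ Icc a b, ℓ e ≤ b - a
  integrable_log : IntegrableOn (fun e => Real.log (ℓ e)) (Icc a b)
  integral_inv : ∀ e ∈ Icc a b, ∀ ε > 0,
    ∫ t in {t | (e, t) ∈ T}, (|t - e| + ε)⁻¹ = Real.log (ℓ e + ε) - Real.log ε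

namespace IsSectionFamily

variable {a b : ℝ} {T : Set (ℝ × ℝ)} {ℓ : ℝ → ℝ}

lemma measurableSet_section (h : IsSectionFamily a b T ℓ) (e : ℝ) :
    MeasurableSet {t | (e, t) ∈ T} :=
  measurable_prodMk_left h.measurableSet

lemma abs_pfOp_zero_le (h : IsSectionFamily a b T ℓ) {β : ℝ} (hβ : 0 < β) {g : ℝ → ℝ}
    {C D e : ℝ} (hC : 0 ≤ C) (he : e ∈ Icc a b)
    (hg : ∀ t, (e, t) ∈ T → |g t - g e| ≤ C * |t - e| ^ β) (hD : |g e| ≤ D) :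
    |pfOp T ℓ 0 g e| ≤ C * (∫ u in Icc (-(b - a)) (b - a), |u| ^ (β - 1))
      + D * (|Real.log (ℓ e)| + |Real.log (b - a + 1)|) :=
  abs_pfOp_le hβ hC he (h.subset e he) (h.measurableSet_section e) hg hD
    ((h.len_nonneg e he).lt_or_eq.imp_right fun h => ⟨h.symm, rfl⟩) (h.len_le e he) le_rfl
    zero_le_one

lemma integrableOn_bound (h : IsSectionFamily a b T ℓ) (B D M : ℝ) :
    IntegrableOn (fun e => B + D * (|Real.log (ℓ e)| + M)) (Icc a b) :=
  (integrable_const B).add ((h.integrable_log.abs.add (integrable_const M)).const_mul D)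

lemma ae_prod_mem {Ω : Type*} [MeasurableSpace Ω] (ν : Measure Ω) :
    ∀ᵐ z : Ω × ℝ ∂(ν.prod (volume.restrict (Icc a b))), z.2 ∈ Icc a b :=
  Measure.quasiMeasurePreserving_snd.ae (ae_restrict_mem measurableSet_Icc)

variable {Ω : Type*} [MeasurableSpace Ω] (ν : Measure Ω) [IsFiniteMeasure ν]

lemma integrable_pfOp (h : IsSectionFamily a b T ℓ) {β : ℝ} (hβ : 0 < β) {P : Ω → ℝ → ℝ → ℝ}
    (hP : Measurable fun q : Ω × ℝ × ℝ => P q.1 q.2.1 q.2.2) {C D : ℝ} (hC : 0 ≤ C)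
    (hD : ∀ ω e t, |P ω e t| ≤ D)
    (hH : ∀ ω, ∀ e ∈ Icc a b, ∀ t, (e, t) ∈ T → |P ω e t - P ω e e| ≤ C * |t - e| ^ β) :
    Integrable (fun z : Ω × ℝ => pfOp T ℓ 0 (P z.1 z.2) z.2)
      (ν.prod (volume.restrict (Icc a b))) := by
  refine Integrable.mono' ((h.integrableOn_bound
    (C * (∫ u in Icc (-(b - a)) (b - a), |u| ^ (β - 1))) D |Real.log (b - a + 1)|).comp_snd ν)
    (measurable_pfOp h.measurableSet h.measurable_len 0 hP).aestronglyMeasurable ?_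
  filter_upwards [ae_prod_mem ν] with z hz
  exact h.abs_pfOp_zero_le hβ hC hz (hH _ _ hz) (hD _ _ _)

lemma tendsto_integral_pfOp (h : IsSectionFamily a b T ℓ) {β : ℝ} (hβ : 0 < β)
    {P : Ω → ℝ → ℝ → ℝ}
    (hP : Measurable fun q : Ω × ℝ × ℝ => P q.1 q.2.1 q.2.2) {C D : ℝ} (hC : 0 ≤ C)
    (hD : ∀ ω e t, |P ω e t| ≤ D)
    (hH : ∀ ω, ∀ e ∈ Icc a b, ∀ t, (e, t) ∈ T → |P ω e t - P ω e e| ≤ C * |t - e| ^ β) :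
    Tendsto (fun ε => ∫ z, pfOp T ℓ ε (P z.1 z.2) z.2 ∂(ν.prod (volume.restrict (Icc a b))))
      (𝓝[>] 0) (𝓝 (∫ z, pfOp T ℓ 0 (P z.1 z.2) z.2 ∂(ν.prod (volume.restrict (Icc a b))))) := by
  have hpos : ∀ᵐ z : Ω × ℝ ∂(ν.prod (volume.restrict (Icc a b))), 0 < ℓ z.2 :=
    Measure.quasiMeasurePreserving_snd.ae h.len_pos
  have hPm : ∀ ω e, Measurable (P ω e) := fun ω e =>
    hP.comp (by fun_prop : Measurable fun t : ℝ => (ω, e, t))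
  refine tendsto_integral_filter_of_dominated_convergence
    (fun z => C * (∫ u in Icc (-(b - a)) (b - a), |u| ^ (β - 1))
      + D * (|Real.log (ℓ z.2)| + |Real.log (b - a + 1)|)) ?_ ?_
    ((h.integrableOn_bound _ _ _).comp_snd ν) ?_
  · exact Eventually.of_forall fun ε =>
      (measurable_pfOp h.measurableSet h.measurable_len ε hP).aestronglyMeasurable
  · filter_upwards [Ioc_mem_nhdsGT (zero_lt_one' ℝ)] with ε hε
    filter_upwards [ae_prod_mem ν, hpos] with z hz hz'
    exact abs_pfOp_le hβ hC hz (h.subset _ hz) (h.measurableSet_section _) (hH _ _ hz) (hD _ _ _)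
      (Or.inl hz') (h.len_le _ hz) hε.1.le hε.2
  · filter_upwards [ae_prod_mem ν, hpos] with z hz hz'
    exact tendsto_pfOp hβ hC hz (h.subset _ hz) (h.measurableSet_section _) (hPm _ _)
      (hH _ _ hz) hz'

lemma abs_indicator_kernel_le (T : Set (ℝ × ℝ)) {ε : ℝ} (hε : 0 < ε) (p : ℝ × ℝ) :
    |T.indicator (fun p => (|p.2 - p.1| + ε)⁻¹) p| ≤ ε⁻¹ := by
  by_cases hp : p ∈ T
  · rw [indicator_of_mem hp, abs_of_nonneg (by positivity)]
    exact inv_anti₀ hε (by linarith [abs_nonneg (p.2 - p.1)])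
  · rw [indicator_of_notMem hp, abs_zero]
    positivity

lemma measurable_indicator_kernel (h : MeasurableSet T) (ε : ℝ) :
    Measurable (T.indicator fun p : ℝ × ℝ => (|p.2 - p.1| + ε)⁻¹) := by
  refine Measurable.indicator ?_ h
  fun_prop

lemma integral_pfOp_eq_of_pos (h : IsSectionFamily a b T ℓ)
    {P : Ω → ℝ → ℝ → ℝ}
    (hP : Measurable fun q : Ω × ℝ × ℝ => P q.1 q.2.1 q.2.2) {D : ℝ}
    (hD : ∀ ω e t, |P ω e t| ≤ D) {ε : ℝ} (hε : 0 < ε) :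
    ∫ z, pfOp T ℓ ε (P z.1 z.2) z.2 ∂(ν.prod (volume.restrict (Icc a b)))
      = (∫ e in Icc a b, ∫ t in Icc a b,
          T.indicator (fun p => (|p.2 - p.1| + ε)⁻¹) (e, t) * ∫ ω, P ω e t ∂ν)
        + Real.log ε * ∫ e in Icc a b, ∫ ω, P ω e e ∂ν := by
  set K : ℝ × ℝ → ℝ := T.indicator fun p => (|p.2 - p.1| + ε)⁻¹ with hK
  have hKm : Measurable K := measurable_indicator_kernel h.measurableSet ε
  have hKb : ∀ p, |K p| ≤ ε⁻¹ := abs_indicator_kernel_le T hε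
  have hPm : ∀ ω e, Measurable (P ω e) := fun ω e =>
    hP.comp (by fun_prop : Measurable fun t : ℝ => (ω, e, t))
  have hdm : Measurable fun z : Ω × ℝ => P z.1 z.2 z.2 :=
    hP.comp (by fun_prop : Measurable fun z : Ω × ℝ => (z.1, z.2, z.2))
  have hDi : Integrable (fun z : Ω × ℝ => P z.1 z.2 z.2) (ν.prod (volume.restrict (Icc a b))) :=
    integrable_of_bounded hdm fun z => hD _ _ _
  have hKPm : Measurable fun q : (Ω × ℝ) × ℝ => K (q.1.2, q.2) * P q.1.1 q.1.2 q.2 :=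
    (hKm.comp (by fun_prop : Measurable fun q : (Ω × ℝ) × ℝ => (q.1.2, q.2))).mul
      (hP.comp (by fun_prop : Measurable fun q : (Ω × ℝ) × ℝ => (q.1.1, q.1.2, q.2)))
  have hKPb : ∀ ω e t, |K (e, t) * P ω e t| ≤ ε⁻¹ * D := fun ω e t => by
    rw [abs_mul]
    exact mul_le_mul (hKb _) (hD _ _ _) (abs_nonneg _) (by positivity)
  have hKPi : Integrable (fun q : (Ω × ℝ) × ℝ => K (q.1.2, q.2) * P q.1.1 q.1.2 q.2)
      ((ν.prod (volume.restrict (Icc a b))).prod (volume.restrict (Icc a b))) :=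
    integrable_of_bounded hKPm fun q => hKPb _ _ _
  have h1 : ∀ᵐ z : Ω × ℝ ∂(ν.prod (volume.restrict (Icc a b))),
      pfOp T ℓ ε (P z.1 z.2) z.2
        = (∫ t in Icc a b, K (z.2, t) * P z.1 z.2 t) + Real.log ε * P z.1 z.2 z.2 := by
    filter_upwards [ae_prod_mem ν] with z hz
    rw [pfOp_eq_of_pos (h.subset _ hz) (hPm _ _) (hD _ _) hε (h.integral_inv _ hz ε hε)]
    congr 1
    rw [← inter_eq_self_of_subset_right (h.subset _ hz),
      ← setIntegral_indicator (h.measurableSet_section _)]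
    congr 1
    funext t
    by_cases ht : (z.2, t) ∈ T
    · rw [hK, indicator_of_mem ht, indicator_of_mem (s := {t | (z.2, t) ∈ T}) ht]
      ring
    · rw [hK, indicator_of_notMem ht, indicator_of_notMem (s := {t | (z.2, t) ∈ T}) ht, zero_mul]
  rw [integral_congr_ae h1, integral_add hKPi.integral_prod_left (hDi.const_mul _),
    integral_const_mul]
  congr 1
  · rw [integral_prod_symm _ hKPi.integral_prod_left]
    refine integral_congr_ae (Eventually.of_forall fun e => ?_)
    simp only
    rw [integral_integral_swap]
    · simp only [integral_const_mul]
    · refine integrable_of_bounded (C := ε⁻¹ * D) ?_ fun q => hKPb _ _ _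
      exact hKPm.comp (by fun_prop : Measurable fun q : Ω × ℝ => ((q.1, e), q.2))
  · rw [integral_prod_symm _ hDi]

/-- Finite part operators over mutually transposed families of sections are adjoint. -/
theorem integral_pfOp_eq_swap {T' : Set (ℝ × ℝ)} {ℓ' : ℝ → ℝ} (h : IsSectionFamily a b T ℓ)
    (h' : IsSectionFamily a b T' ℓ') (hTT' : ∀ e t, (e, t) ∈ T ↔ (t, e) ∈ T') {β : ℝ}
    (hβ : 0 < β) {P Q : Ω → ℝ → ℝ → ℝ}
    (hP : Measurable fun q : Ω × ℝ × ℝ => P q.1 q.2.1 q.2.2)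
    (hQ : Measurable fun q : Ω × ℝ × ℝ => Q q.1 q.2.1 q.2.2) {C D C' D' : ℝ} (hC : 0 ≤ C)
    (hD : ∀ ω e t, |P ω e t| ≤ D) (hC' : 0 ≤ C') (hD' : ∀ ω e t, |Q ω e t| ≤ D')
    (hH : ∀ ω, ∀ e ∈ Icc a b, ∀ t, (e, t) ∈ T → |P ω e t - P ω e e| ≤ C * |t - e| ^ β)
    (hH' : ∀ ω, ∀ e ∈ Icc a b, ∀ t, (e, t) ∈ T' → |Q ω e t - Q ω e e| ≤ C' * |t - e| ^ β)
    (hPQ : ∀ e ∈ Icc a b, ∀ t, (e, t) ∈ T → ∫ ω, P ω e t ∂ν = ∫ ω, Q ω t e ∂ν)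
    (hPQd : ∀ e ∈ Icc a b, ∫ ω, P ω e e ∂ν = ∫ ω, Q ω e e ∂ν) :
    ∫ z, pfOp T ℓ 0 (P z.1 z.2) z.2 ∂(ν.prod (volume.restrict (Icc a b)))
      = ∫ z, pfOp T' ℓ' 0 (Q z.1 z.2) z.2 ∂(ν.prod (volume.restrict (Icc a b))) := by
  refine tendsto_nhds_unique (h.tendsto_integral_pfOp ν hβ hP hC hD hH)
    ((h'.tendsto_integral_pfOp ν hβ hQ hC' hD' hH').congr' ?_)
  filter_upwards [self_mem_nhdsWithin] with ε hε
  replace hε : 0 < ε := hε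
  rw [h.integral_pfOp_eq_of_pos ν hP hD hε, h'.integral_pfOp_eq_of_pos ν hQ hD' hε]
  congr 1
  · rw [integral_integral_swap]
    · refine setIntegral_congr_fun measurableSet_Icc fun e he => ?_
      refine setIntegral_congr_fun measurableSet_Icc fun t _ => ?_
      by_cases hmem : (e, t) ∈ T
      · simp only [indicator_of_mem hmem, indicator_of_mem ((hTT' e t).mp hmem), hPQ e he t hmem,
          abs_sub_comm t e]
      · simp only [indicator_of_notMem hmem, indicator_of_notMem (mt (hTT' e t).mpr hmem),
          zero_mul]
    · have hm : Measurable fun p : ℝ × ℝ => ∫ ω, Q ω p.1 p.2 ∂ν :=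
        (hQ.comp (by fun_prop : Measurable fun q : (ℝ × ℝ) × Ω =>
          (q.2, q.1.1, q.1.2))).stronglyMeasurable.integral_prod_right'.measurable
      refine integrable_of_bounded ((measurable_indicator_kernel h'.measurableSet ε).mul hm)
        (C := ε⁻¹ * (D' * ν.real univ)) fun p => ?_
      rw [Function.uncurry, abs_mul]
      exact mul_le_mul (abs_indicator_kernel_le T' hε p)
        (norm_integral_le_of_norm_le_const (f := fun ω => Q ω p.1 p.2)
          (Eventually.of_forall fun ω => hD' ω _ _))
        (abs_nonneg _) (by positivity)
  · congr 1
    exact setIntegral_congr_fun measurableSet_Icc fun e he => (hPQd e he).symm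

end IsSectionFamily

/-- The triangle above the diagonal of `[a,b]²`. -/
def upperTri (a b : ℝ) : Set (ℝ × ℝ) := {p | a ≤ p.1 ∧ p.1 < p.2 ∧ p.2 ≤ b}

/-- The triangle below the diagonal of `[a,b]²`. -/
def lowerTri (a b : ℝ) : Set (ℝ × ℝ) := {p | a ≤ p.2 ∧ p.2 < p.1 ∧ p.1 ≤ b}

lemma upperTri_section {a b e : ℝ} (he : a ≤ e) : {t | (e, t) ∈ upperTri a b} = Ioc e b := by
  ext t
  simp [upperTri, he]

lemma lowerTri_section {a b e : ℝ} (he : e ≤ b) : {t | (e, t) ∈ lowerTri a b} = Ico a e := by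
  ext t
  simp [lowerTri, he]

lemma measurableSet_upperTri (a b : ℝ) : MeasurableSet (upperTri a b) :=
  (measurableSet_le measurable_const measurable_fst).inter
    ((measurableSet_lt measurable_fst measurable_snd).inter
      (measurableSet_le measurable_snd measurable_const))

lemma measurableSet_lowerTri (a b : ℝ) : MeasurableSet (lowerTri a b) :=
  (measurableSet_le measurable_const measurable_snd).inter
    ((measurableSet_lt measurable_snd measurable_fst).inter
      (measurableSet_le measurable_fst measurable_const))

lemma intervalIntegral_inv_add {l ε : ℝ} (hl : 0 ≤ l) (hε : 0 < ε) :
    ∫ u in (0 : ℝ)..l, (u + ε)⁻¹ = Real.log (l + ε) - Real.log ε := by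
  rw [intervalIntegral.integral_comp_add_right (fun u => u⁻¹), zero_add,
    integral_inv_of_pos hε (by linarith), Real.log_div (by linarith) hε.ne']

lemma isSectionFamily_upperTri {a b : ℝ} (hab : a < b) :
    IsSectionFamily a b (upperTri a b) fun e => b - e where
  measurableSet := measurableSet_upperTri a b
  subset e he := by
    rw [upperTri_section he.1]
    exact fun t ht => ⟨he.1.trans ht.1.le, ht.2⟩
  measurable_len := by fun_prop
  len_pos := by
    rw [← restrict_Ico_eq_restrict_Icc]
    filter_upwards [ae_restrict_mem measurableSet_Ico] with e he
    linarith [he.2]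
  len_nonneg e he := by linarith [he.2]
  len_le e he := by linarith [he.1]
  integrable_log := by
    have := (intervalIntegral.intervalIntegrable_log' (a := 0) (b := b - a)).comp_sub_left b
    rw [sub_zero, sub_sub_cancel] at this
    exact (intervalIntegrable_iff_integrableOn_Icc_of_le hab.le).mp this.symm
  integral_inv e he ε hε := by
    rw [upperTri_section he.1, ← intervalIntegral_inv_add (by linarith [he.2]) hε]
    have := intervalIntegral.integral_comp_sub_right (a := e) (b := b) (fun u => (u + ε)⁻¹) e
    rw [sub_self] at this
    rw [← this, intervalIntegral.integral_of_le he.2]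
    refine setIntegral_congr_fun measurableSet_Ioc fun t ht => ?_
    simp only [abs_of_pos (sub_pos.mpr ht.1)]

lemma isSectionFamily_lowerTri {a b : ℝ} (hab : a < b) :
    IsSectionFamily a b (lowerTri a b) fun e => e - a where
  measurableSet := measurableSet_lowerTri a b
  subset e he := by
    rw [lowerTri_section he.2]
    exact fun t ht => ⟨ht.1, ht.2.le.trans he.2⟩
  measurable_len := by fun_prop
  len_pos := by
    rw [← restrict_Ioc_eq_restrict_Icc]
    filter_upwards [ae_restrict_mem measurableSet_Ioc] with e he
    linarith [he.1]
  len_nonneg e he := by linarith [he.1]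
  len_le e he := by linarith [he.2]
  integrable_log := by
    have := (intervalIntegral.intervalIntegrable_log' (a := 0) (b := b - a)).comp_sub_right a
    rw [zero_add, sub_add_cancel] at this
    exact (intervalIntegrable_iff_integrableOn_Icc_of_le hab.le).mp this
  integral_inv e he ε hε := by
    rw [lowerTri_section he.2, ← intervalIntegral_inv_add (by linarith [he.1]) hε]
    have := intervalIntegral.integral_comp_sub_left (a := a) (b := e) (fun u => (u + ε)⁻¹) e
    rw [sub_self] at this
    rw [← this, intervalIntegral.integral_of_le he.1, ← integral_Ico_eq_integral_Ioc]
    refine setIntegral_congr_fun measurableSet_Ico fun t ht => ?_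
    simp only [abs_sub_comm t e, abs_of_pos (sub_pos.mpr ht.2)]

lemma hasPF1Upper_of_holder {β : ℝ} (hβ : 0 < β) {g : ℝ → ℝ} {x b C : ℝ} (hxb : x < b)
    (hC : 0 ≤ C) (hgm : AEStronglyMeasurable g (volume.restrict (Ioc x b)))
    (hg : ∀ t ∈ Ioc x b, |g t - g x| ≤ C * |t - x| ^ β) :
    HasPF1Upper g x b ((∫ t in x..b, (g t - g x) / (t - x)) + g x * Real.log (b - x)) := by
  have hInt : IntegrableOn (fun t => (g t - g x) / (t - x)) (Icc x b) := by
    rw [integrableOn_Icc_iff_integrableOn_Ioc]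
    have h1 := ((integrableOn_abs_sub_rpow hβ (left_mem_Icc.mpr hxb.le)).1.mono_set
      Ioc_subset_Icc_self).const_mul C
    refine h1.mono' ?_ ((ae_restrict_iff' measurableSet_Ioc).mpr
      (Eventually.of_forall fun t ht => ?_))
    · have : Measurable fun t : ℝ => t - x := by fun_prop
      exact ((hgm.aemeasurable.sub_const _).div this.aemeasurable).aestronglyMeasurable
    · have h2 := pfOp_integrand_bound hC (hg t ht) le_rfl
      have h3 : |t - x| + 0 = t - x := by rw [add_zero, abs_of_pos (sub_pos.mpr ht.1)]
      rwa [h3] at h2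
  have hcont := intervalIntegral.continuousOn_primitive_interval_left (a := x) (b := b)
    (f := fun t => (g t - g x) / (t - x)) (μ := volume) (by rwa [uIcc_of_le hxb.le])
  rw [uIcc_of_le hxb.le] at hcont
  have hlim : Tendsto (fun ε : ℝ => x + ε) (𝓝[>] 0) (𝓝[Icc x b] x) := by
    refine tendsto_nhdsWithin_iff.mpr ⟨?_, ?_⟩
    · have : Tendsto (fun ε : ℝ => x + ε) (𝓝 0) (𝓝 (x + 0)) :=
        (continuous_const.add continuous_id).tendsto 0
      rw [add_zero] at this
      exact this.mono_left nhdsWithin_le_nhds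
    · filter_upwards [Ioc_mem_nhdsGT (sub_pos.mpr hxb)] with ε hε
      exact ⟨by linarith [hε.1], by linarith [hε.2]⟩
  have h0 := ((hcont x (left_mem_Icc.mpr hxb.le)).tendsto.comp hlim).add_const
    (g x * Real.log (b - x))
  refine h0.congr' ?_
  filter_upwards [Ioo_mem_nhdsGT (sub_pos.mpr hxb)] with ε hε
  have hlt : x + ε < b := by linarith [hε.2]
  have hii : IntervalIntegrable (fun t => (g t - g x) / (t - x)) volume (x + ε) b :=
    (intervalIntegrable_iff_integrableOn_Icc_of_le hlt.le).mpr
      (hInt.mono_set (Icc_subset_Icc_left (by linarith [hε.1])))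
  have hci : IntervalIntegrable (fun t => g x * (t - x)⁻¹) volume (x + ε) b := by
    refine ContinuousOn.intervalIntegrable fun t ht => ?_
    rw [uIcc_of_le hlt.le] at ht
    have : t - x ≠ 0 := by linarith [ht.1, hε.1]
    exact ContinuousAt.continuousWithinAt (by fun_prop (disch := assumption))
  have hsum : ∫ t in (x + ε)..b, g t / (t - x)
      = (∫ t in (x + ε)..b, (g t - g x) / (t - x)) + ∫ t in (x + ε)..b, g x * (t - x)⁻¹ := by
    rw [← intervalIntegral.integral_add hii hci]
    congr 1
    funext t
    ring
  have hlog : ∫ t in (x + ε)..b, g x * (t - x)⁻¹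
      = g x * (Real.log (b - x) - Real.log ε) := by
    rw [intervalIntegral.integral_const_mul,
      intervalIntegral.integral_comp_sub_right (fun u => u⁻¹), add_sub_cancel_left,
      integral_inv_of_pos hε.1 (by linarith), Real.log_div (by linarith) hε.1.ne']
  simp only [Function.comp_apply]
  rw [hsum, hlog]
  ring

lemma hasPF1Lower_of_neg {g : ℝ → ℝ} {a x L : ℝ}
    (h : HasPF1Upper (fun t => g (-t)) (-x) (-a) L) : HasPF1Lower g a x L := by
  refine Tendsto.congr (fun ε => ?_) h
  have h1 : -x + ε = -(x - ε) := by ring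
  rw [h1, ← intervalIntegral.integral_comp_neg]
  simp only [neg_neg]
  congr 2
  funext t
  congr 1
  ring

lemma hasPF1Upper_pfOp {β : ℝ} (hβ : 0 < β) {g g' : ℝ → ℝ} {a b e C : ℝ} (he : e ∈ Ico a b)
    (hC : 0 ≤ C) (hgm : Measurable g)
    (hg : ∀ t, (e, t) ∈ upperTri a b → |g t - g e| ≤ C * |t - e| ^ β)
    (hgg' : ∀ t ∈ Icc e b, g' t = g t) :
    HasPF1Upper g' e b (pfOp (upperTri a b) (fun e => b - e) 0 g e) := by
  have hee : g' e = g e := hgg' e (left_mem_Icc.mpr he.2.le)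
  have hval : pfOp (upperTri a b) (fun e => b - e) 0 g e
      = (∫ t in e..b, (g' t - g' e) / (t - e)) + g' e * Real.log (b - e) := by
    unfold pfOp
    rw [upperTri_section he.1, add_zero, intervalIntegral.integral_of_le he.2.le, hee]
    congr 1
    refine setIntegral_congr_fun measurableSet_Ioc fun t ht => ?_
    simp only [add_zero, abs_of_pos (sub_pos.mpr ht.1), hgg' t (Ioc_subset_Icc_self ht)]
  rw [hval]
  refine hasPF1Upper_of_holder hβ he.2 hC ?_ fun t ht => ?_
  · refine hgm.aestronglyMeasurable.congr ((ae_restrict_iff' measurableSet_Ioc).mpr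
      (Eventually.of_forall fun t ht => (hgg' t (Ioc_subset_Icc_self ht)).symm))
  · rw [hee, hgg' t (Ioc_subset_Icc_self ht)]
    exact hg t ⟨he.1, ht⟩

lemma hasPF1Lower_pfOp {β : ℝ} (hβ : 0 < β) {g g' : ℝ → ℝ} {a b e C : ℝ} (he : e ∈ Ioc a b)
    (hC : 0 ≤ C) (hgm : Measurable g)
    (hg : ∀ t, (e, t) ∈ lowerTri a b → |g t - g e| ≤ C * |t - e| ^ β)
    (hgg' : ∀ t ∈ Icc a e, g' t = g t) :
    HasPF1Lower g' a e (pfOp (lowerTri a b) (fun e => e - a) 0 g e) := by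
  have hee : g' e = g e := hgg' e (right_mem_Icc.mpr he.1.le)
  have hval : pfOp (lowerTri a b) (fun e => e - a) 0 g e
      = (∫ t in (-e)..(-a), (g' (-t) - g' (- -e)) / (t - -e))
        + g' (- -e) * Real.log (-a - -e) := by
    unfold pfOp
    rw [lowerTri_section he.2, add_zero, neg_neg,
      ← intervalIntegral.integral_comp_neg (a := a) (b := e)
        (fun t => (g' (-t) - g' e) / (t - -e)), intervalIntegral.integral_of_le he.1.le,
      ← integral_Ico_eq_integral_Ioc, hee, neg_sub_neg]
    congr 1
    refine setIntegral_congr_fun measurableSet_Ico fun t ht => ?_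
    simp only [add_zero, abs_sub_comm t e, abs_of_pos (sub_pos.mpr ht.2), neg_neg,
      neg_sub_neg, hgg' t (Ico_subset_Icc_self ht)]
  rw [hval]
  refine hasPF1Lower_of_neg (hasPF1Upper_of_holder hβ (neg_lt_neg he.1) hC ?_ fun t ht => ?_)
  · refine (hgm.comp measurable_neg).aestronglyMeasurable.congr
      ((ae_restrict_iff' measurableSet_Ioc).mpr (Eventually.of_forall fun t ht =>
        (hgg' (-t) ⟨by linarith [ht.2], by linarith [ht.1]⟩).symm))
  · rw [neg_neg, hee, hgg' (-t) ⟨by linarith [ht.2], by linarith [ht.1]⟩]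
    have := hg (-t) ⟨by linarith [ht.2], by simpa using neg_lt.mp ht.1, he.2⟩
    have h2 : |-t - e| = |t - -e| := by rw [← abs_neg]; congr 1; ring
    rwa [h2] at this

lemma IsSectionFamily.integrableOn_integral_abs_pfOp {a b : ℝ} {T : Set (ℝ × ℝ)} {ℓ : ℝ → ℝ}
    (h : IsSectionFamily a b T ℓ) {X Ω : Type*} [MeasurableSpace X] [MeasurableSpace Ω]
    {m : Measure X} {ν : Measure Ω} [IsFiniteMeasure ν] {G : Set X} (hG : MeasurableSet G)
    (hGfin : m G ≠ ⊤) {β : ℝ} (hβ : 0 < β) {P : X → Ω → ℝ → ℝ → ℝ}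
    (hP : Measurable fun q : (X × Ω) × ℝ × ℝ => P q.1.1 q.1.2 q.2.1 q.2.2) {C D : ℝ} (hC : 0 ≤ C)
    (hD : ∀ x ω e t, |P x ω e t| ≤ D)
    (hH : ∀ x ∈ G, ∀ ω, ∀ e ∈ Icc a b, ∀ t, (e, t) ∈ T →
      |P x ω e t - P x ω e e| ≤ C * |t - e| ^ β) :
    IntegrableOn (fun x => ∫ ω, (∫ e in Icc a b, |pfOp T ℓ 0 (P x ω e) e|) ∂ν) G m := by
  have hmeas : Measurable fun x => ∫ ω, (∫ e in Icc a b, |pfOp T ℓ 0 (P x ω e) e|) ∂ν := by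
    have h1 : Measurable fun z : (X × Ω) × ℝ => |pfOp T ℓ 0 (P z.1.1 z.1.2 z.2) z.2| :=
      continuous_abs.measurable.comp
        (measurable_pfOp h.measurableSet h.measurable_len 0
          (F := fun y : X × Ω => P y.1 y.2) hP)
    have h2 : StronglyMeasurable fun y : X × Ω =>
        ∫ e in Icc a b, |pfOp T ℓ 0 (P y.1 y.2 e) e| :=
      h1.stronglyMeasurable.integral_prod_right'
    exact h2.integral_prod_right'.measurable
  set N : ℝ := ∫ e in Icc a b, (C * (∫ u in Icc (-(b - a)) (b - a), |u| ^ (β - 1))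
      + D * (|Real.log (ℓ e)| + |Real.log (b - a + 1)|))
  refine IntegrableOn.of_bound hGfin.lt_top hmeas.aestronglyMeasurable (N * ν.real univ)
    ((ae_restrict_iff' hG).mpr (Eventually.of_forall fun x hx => ?_))
  refine norm_integral_le_of_norm_le_const (Eventually.of_forall fun ω => ?_)
  refine norm_integral_le_of_norm_le (h.integrableOn_bound _ _ _)
    ((ae_restrict_iff' measurableSet_Icc).mpr (Eventually.of_forall fun e he => ?_))
  rw [Real.norm_eq_abs, abs_abs]
  exact h.abs_pfOp_zero_le hβ hC he (hH x hx ω e he) (hD _ _ _ _)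

lemma exists_measurable_bounded_extension {X : Type*} [TopologicalSpace X] [T2Space X]
    [MeasurableSpace X] [OpensMeasurableSpace X] {K : Set X} (hK : IsCompact K) {f : X → ℝ}
    (hf : ContinuousOn f K) :
    ∃ (g : X → ℝ) (B : ℝ), Measurable g ∧ 0 ≤ B ∧ (∀ x, |g x| ≤ B) ∧ (∀ x ∈ K, g x = f x) ∧
      ∀ x ∉ K, g x = 0 := by
  classical
  obtain ⟨B, hB⟩ := hK.exists_bound_of_continuousOn hf
  refine ⟨K.piecewise f 0, max B 0, hf.measurable_piecewise continuousOn_const hK.measurableSet,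
    le_max_right _ _, fun x => ?_, fun x hx => piecewise_eq_of_mem _ _ _ hx,
    fun x hx => piecewise_eq_of_notMem _ _ _ hx⟩
  by_cases hx : x ∈ K
  · rw [piecewise_eq_of_mem _ _ _ hx]
    exact (hB x hx).trans (le_max_left _ _)
  · rw [piecewise_eq_of_notMem _ _ _ hx]
    simp

lemma mu_nonneg (E' E : ℝ) : 0 ≤ mu E' E := Real.sqrt_nonneg _

lemma mu_self {E : ℝ} (hE : 0 < E) : mu E E = 1 := by
  unfold mu
  rw [div_self (by positivity), Real.sqrt_one]

lemma one_sub_mu_sq {E' E : ℝ} (hE : 0 < E) (hEE' : E ≤ E') :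
    1 - mu E' E ^ 2 = 2 * (E' - E) / (E' * (E + 2)) := by
  have hE' : 0 < E' := hE.trans_le hEE'
  unfold mu
  rw [Real.sq_sqrt (by positivity)]
  field_simp
  ring

lemma mu_le_one {E' E : ℝ} (hE : 0 < E) (hEE' : E ≤ E') : mu E' E ≤ 1 := by
  have hE' : 0 < E' := hE.trans_le hEE'
  have h := one_sub_mu_sq hE hEE'
  have h2 : 0 ≤ 2 * (E' - E) / (E' * (E + 2)) :=
    div_nonneg (by linarith) (by positivity)
  nlinarith [mu_nonneg E' E]

lemma sqrt_sq_add_sq {d : ℝ} (hd0 : 0 ≤ d) (hd1 : d ≤ 1) :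
    Real.sqrt (1 - d ^ 2) ^ 2 + d ^ 2 = 1 := by
  rw [Real.sq_sqrt (by nlinarith)]
  ring

lemma circ_zero_one (s : ℝ) : circ 0 1 s = e₃ := by
  ext i
  fin_cases i <;> simp [circ, vec3, e₃]

lemma norm_circ_sub_e₃_le {d : ℝ} (hd0 : 0 ≤ d) (hd1 : d ≤ 1) (s : ℝ) :
    ‖circ (Real.sqrt (1 - d ^ 2)) d s - e₃‖ ≤ Real.sqrt (2 * (1 - d ^ 2)) := by
  have h := sqrt_sq_add_sq hd0 hd1
  set c := Real.sqrt (1 - d ^ 2)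
  rw [EuclideanSpace.norm_eq]
  refine Real.sqrt_le_sqrt ?_
  simp [circ, vec3, e₃, Fin.sum_univ_three]
  nlinarith [Real.sin_sq_add_cos_sq s]

lemma norm_circ_mu_sub_e₃_le {E₀ E' E : ℝ} (hE₀ : 0 < E₀) (hE : E₀ ≤ E) (hEE' : E ≤ E') (s : ℝ) :
    ‖circ (Real.sqrt (1 - mu E' E ^ 2)) (mu E' E) s - e₃‖
      ≤ Real.sqrt (2 / E₀) * Real.sqrt (E' - E) := by
  have hE0 : 0 < E := hE₀.trans_le hE
  refine (norm_circ_sub_e₃_le (mu_nonneg _ _) (mu_le_one hE0 hEE') s).trans ?_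
  rw [← Real.sqrt_mul (by positivity)]
  refine Real.sqrt_le_sqrt ?_
  rw [one_sub_mu_sq hE0 hEE', ← mul_div_assoc, div_mul_eq_mul_div]
  have hE' : 0 < E' := hE0.trans_le hEE'
  have h : 2 * E₀ ≤ E' * (E + 2) := by nlinarith
  rw [div_le_div_iff₀ (by positivity) hE₀]
  nlinarith [mul_le_mul_of_nonneg_left h (by linarith : 0 ≤ 2 * (E' - E))]

/-- The kernel `K x e t ∫₀^{2π} F x (γ(s)) t ds`, where `γ` parametrizes the circle around `ω` of
points having inner product `M e t` with `ω`. -/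
def circKer (R : E3 → (E3 ≃ₗᵢ[ℝ] E3)) (M : ℝ → ℝ → ℝ) (K : E3 × ℝ × ℝ → ℝ)
    (F : E3 × E3 × ℝ → ℝ) (x ω : E3) (e t : ℝ) : ℝ :=
  K (x, e, t) * ∫ s in (0 : ℝ)..(2 * π),
    F (x, R ω (circ (Real.sqrt (1 - M e t ^ 2)) (M e t) s), t)

section circKer

variable {R : E3 → (E3 ≃ₗᵢ[ℝ] E3)} {M : ℝ → ℝ → ℝ} {K : E3 × ℝ × ℝ → ℝ} {F : E3 × E3 × ℝ → ℝ}

lemma measurable_circKer (hRm : ∀ w : E3, Measurable fun ω => R ω w)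
    (hM : Measurable fun p : ℝ × ℝ => M p.1 p.2) (hK : Measurable K) (hF : Measurable F) :
    Measurable fun q : (E3 × E3) × ℝ × ℝ => circKer R M K F q.1.1 q.1.2 q.2.1 q.2.2 := by
  unfold circKer
  refine Measurable.mul (hK.comp (by fun_prop :
    Measurable fun q : (E3 × E3) × ℝ × ℝ => (q.1.1, q.2.1, q.2.2))) ?_
  simp only [intervalIntegral.integral_of_le Real.two_pi_pos.le]
  have hMq : Measurable fun q : ((E3 × E3) × ℝ × ℝ) × ℝ => M q.1.2.1 q.1.2.2 :=
    hM.comp (by fun_prop : Measurable fun q : ((E3 × E3) × ℝ × ℝ) × ℝ => (q.1.2.1, q.1.2.2))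
  have hcirc : Measurable fun y : ℝ × ℝ × ℝ => circ y.1 y.2.1 y.2.2 := by
    have : Continuous fun y : ℝ × ℝ × ℝ => circ y.1 y.2.1 y.2.2 := by
      unfold circ vec3
      refine (EuclideanSpace.equiv (Fin 3) ℝ).symm.continuous.comp (continuous_pi fun i => ?_)
      fin_cases i <;> simp <;> fun_prop
    exact this.measurable
  have hp : Measurable fun q : ((E3 × E3) × ℝ × ℝ) × ℝ =>
      R q.1.1.2 (circ (Real.sqrt (1 - M q.1.2.1 q.1.2.2 ^ 2)) (M q.1.2.1 q.1.2.2) q.2) :=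
    (measurable_frame hRm).comp (Measurable.prodMk (by fun_prop) (hcirc.comp
      (Measurable.prodMk (((hMq.pow_const 2).const_sub 1).sqrt) (hMq.prodMk measurable_snd))))
  have hall : Measurable fun q : ((E3 × E3) × ℝ × ℝ) × ℝ => F (q.1.1.1,
      R q.1.1.2 (circ (Real.sqrt (1 - M q.1.2.1 q.1.2.2 ^ 2)) (M q.1.2.1 q.1.2.2) q.2),
      q.1.2.2) :=
    hF.comp (Measurable.prodMk (by fun_prop) (hp.prodMk (by fun_prop)))
  exact hall.stronglyMeasurable.integral_prod_right'.measurable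

lemma abs_circKer_le {BK BF : ℝ} (hBK0 : 0 ≤ BK) (hBK : ∀ p, |K p| ≤ BK) (hBF : ∀ p, |F p| ≤ BF)
    (x ω : E3) (e t : ℝ) : |circKer R M K F x ω e t| ≤ BK * (BF * (2 * π)) := by
  unfold circKer
  rw [abs_mul]
  exact mul_le_mul (hBK _) (abs_intervalIntegral_two_pi_le fun s => hBF _) (abs_nonneg _) hBK0

lemma exists_holder_circKer (hR : ∀ ω : E3, ‖ω‖ = 1 → R ω e₃ = ω) {X : Set E3} {a b α A : ℝ}
    (hab : a < b) (hα : 0 < α) (hA : 0 ≤ A) {T : Set (ℝ × ℝ)}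
    (hT : ∀ e ∈ Icc a b, {t | (e, t) ∈ T} ⊆ Icc a b)
    (hM : ∀ e ∈ Icc a b, ∀ t, (e, t) ∈ T → 0 ≤ M e t ∧ M e t ≤ 1 ∧
      ∀ s, ‖circ (Real.sqrt (1 - M e t ^ 2)) (M e t) s - e₃‖ ≤ A * Real.sqrt |t - e|)
    (hMd : ∀ e ∈ Icc a b, M e e = 1) {BK BF CK CF : ℝ} (hBK0 : 0 ≤ BK) (hBK : ∀ p, |K p| ≤ BK)
    (hBF0 : 0 ≤ BF) (hF : Measurable F) (hBF : ∀ p, |F p| ≤ BF)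
    (hKH : ∀ x ∈ X, ∀ e ∈ Icc a b, ∀ t ∈ Icc a b, |K (x, e, t) - K (x, e, e)| ≤ CK * |t - e| ^ α)
    (hFH : ∀ x ∈ X, ∀ ω₁ ∈ sphere (0 : E3) 1, ∀ E₁ ∈ Icc a b, ∀ ω₂ ∈ sphere (0 : E3) 1,
      ∀ E₂ ∈ Icc a b, |F (x, ω₁, E₁) - F (x, ω₂, E₂)| ≤ CF * (‖ω₁ - ω₂‖ + |E₁ - E₂|) ^ α) :
    ∃ C, 0 ≤ C ∧ ∀ x ∈ X, ∀ ω ∈ sphere (0 : E3) 1, ∀ e ∈ Icc a b, ∀ t, (e, t) ∈ T →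
      |circKer R M K F x ω e t - circKer R M K F x ω e e| ≤ C * |t - e| ^ (α / 2) := by
  refine ⟨|CK| * (b - a) ^ (α / 2) * (BF * (2 * π))
    + BK * (|CF| * (A + Real.sqrt (b - a)) ^ α * (2 * π)), ?_, fun x hx ω hω e he t ht => ?_⟩
  · have : 0 ≤ b - a := by linarith
    positivity
  have hba : 0 ≤ b - a := by linarith
  have htI := hT e he ht
  have hω1 : ‖ω‖ = 1 := mem_sphere_zero_iff_norm.mp hω
  obtain ⟨hM0, hM1, hMs⟩ := hM e he t ht
  have hdist : |t - e| ≤ b - a := by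
    rw [abs_le]
    constructor <;> linarith [he.1, he.2, htI.1, htI.2]
  have hhalf : (Real.sqrt |t - e|) ^ α = |t - e| ^ (α / 2) := by
    rw [Real.sqrt_eq_rpow, ← Real.rpow_mul (abs_nonneg _)]
    congr 1
    ring
  have hroot : |t - e| ≤ Real.sqrt (b - a) * Real.sqrt |t - e| := by
    calc |t - e| = Real.sqrt |t - e| * Real.sqrt |t - e| := (Real.mul_self_sqrt (abs_nonneg _)).symm
      _ ≤ _ := mul_le_mul_of_nonneg_right (Real.sqrt_le_sqrt hdist) (Real.sqrt_nonneg _)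
  have hK1 : |K (x, e, t) - K (x, e, e)| ≤ |CK| * (b - a) ^ (α / 2) * |t - e| ^ (α / 2) := by
    refine (hKH x hx e he t htI).trans ?_
    have h1 : |t - e| ^ α = |t - e| ^ (α / 2) * |t - e| ^ (α / 2) := by
      rw [← Real.rpow_add_of_nonneg (abs_nonneg _) (by positivity) (by positivity), add_halves]
    rw [h1, ← mul_assoc]
    refine mul_le_mul_of_nonneg_right ?_ (by positivity)
    exact mul_le_mul (le_abs_self _) (Real.rpow_le_rpow (abs_nonneg _) hdist (by positivity))
      (by positivity) (abs_nonneg _)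
  have hF1 : ∀ s, |F (x, R ω (circ (Real.sqrt (1 - M e t ^ 2)) (M e t) s), t) - F (x, ω, e)|
      ≤ |CF| * (A + Real.sqrt (b - a)) ^ α * |t - e| ^ (α / 2) := by
    intro s
    set p := circ (Real.sqrt (1 - M e t ^ 2)) (M e t) s with hp
    have hpn : ‖p‖ = 1 := norm_circ (sqrt_sq_add_sq hM0 hM1) s
    have hRp : R ω p ∈ sphere (0 : E3) 1 := by
      rw [mem_sphere_zero_iff_norm, (R ω).norm_map, hpn]
    have hd : ‖R ω p - ω‖ = ‖p - e₃‖ := by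
      rw [← (R ω).norm_map (p - e₃), map_sub, hR ω hω1]
    refine (hFH x hx _ hRp t htI ω hω e he).trans ?_
    rw [mul_assoc, ← hhalf, ← Real.mul_rpow (by positivity) (Real.sqrt_nonneg _)]
    refine mul_le_mul (le_abs_self _) (Real.rpow_le_rpow (by positivity) ?_ hα.le)
      (by positivity) (abs_nonneg _)
    rw [hd, add_mul]
    exact add_le_add (hMs s) hroot
  have hdiag : circKer R M K F x ω e e = K (x, e, e) * ∫ s in (0 : ℝ)..(2 * π), F (x, ω, e) := by
    unfold circKer
    simp only [hMd e he, one_pow, sub_self, Real.sqrt_zero, circ_zero_one, hR ω hω1]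
  have hint : IntervalIntegrable
      (fun s => F (x, R ω (circ (Real.sqrt (1 - M e t ^ 2)) (M e t) s), t)) volume 0 (2 * π) := by
    rw [intervalIntegrable_iff_integrableOn_Ioc_of_le Real.two_pi_pos.le]
    refine integrable_of_bounded (hF.comp ?_) fun s => hBF _
    exact measurable_const.prodMk ((((R ω).continuous.comp
      (continuous_circ _ _)).measurable).prodMk measurable_const)
  have hsplit : circKer R M K F x ω e t - circKer R M K F x ω e e
      = (K (x, e, t) - K (x, e, e)) * (∫ s in (0 : ℝ)..(2 * π),
          F (x, R ω (circ (Real.sqrt (1 - M e t ^ 2)) (M e t) s), t))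
        + K (x, e, e) * ∫ s in (0 : ℝ)..(2 * π),
          (F (x, R ω (circ (Real.sqrt (1 - M e t ^ 2)) (M e t) s), t) - F (x, ω, e)) := by
    rw [hdiag, intervalIntegral.integral_sub hint (by simp), circKer]
    ring
  rw [hsplit]
  refine (abs_add_le _ _).trans ?_
  rw [abs_mul, abs_mul, add_mul]
  refine add_le_add ?_ ?_
  · refine (mul_le_mul hK1 (abs_intervalIntegral_two_pi_le fun s => hBF _) (abs_nonneg _)
      (by positivity)).trans_eq (by ring)
  · refine (mul_le_mul (hBK _) (abs_intervalIntegral_two_pi_le hF1) (abs_nonneg _) hBK0).trans_eq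
      (by ring)

end circKer

section pairing

variable {R : E3 → (E3 ≃ₗᵢ[ℝ] E3)} {M M' : ℝ → ℝ → ℝ} {K K' : E3 × ℝ × ℝ → ℝ}
  {F W : E3 × E3 × ℝ → ℝ}

lemma integral_mul_circKer_comm (hR : ∀ ω : E3, ‖ω‖ = 1 → R ω e₃ = ω)
    (hRm : ∀ w : E3, Measurable fun ω => R ω w) (hF : Measurable F) (hW : Measurable W)
    {BF BW : ℝ} (hBF : ∀ p, |F p| ≤ BF) (hBW : ∀ p, |W p| ≤ BW) {x : E3} {e t : ℝ}
    (hM : M' t e = M e t) (hM0 : 0 ≤ M e t) (hM1 : M e t ≤ 1) (hK : K' (x, t, e) = K (x, e, t)) :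
    ∫ ω, W (x, ω, e) * circKer R M K F x ω e t ∂nuS
      = ∫ ω, F (x, ω, t) * circKer R M' K' W x ω t e ∂nuS := by
  have h := circle_average_symmetric hR hRm (f := fun ω => W (x, ω, e))
    (h := fun ω => F (x, ω, t)) (hW.comp (by fun_prop)) (hF.comp (by fun_prop))
    (fun ω => hBW _) (fun ω => hBF _) (sqrt_sq_add_sq hM0 hM1)
  unfold circKer
  rw [hM, hK]
  simp only [mul_left_comm _ (K (x, e, t))]
  rw [integral_const_mul, integral_const_mul, h]

lemma holder_mul_circKer {X : Set E3} {I : Set ℝ} {T : Set (ℝ × ℝ)} {β C BW : ℝ}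
    (hBW0 : 0 ≤ BW) (hBW : ∀ p, |W p| ≤ BW)
    (hW0 : ∀ x, ∀ ω ∉ sphere (0 : E3) 1, ∀ e, W (x, ω, e) = 0)
    (hC0 : 0 ≤ C) (hC : ∀ x ∈ X, ∀ ω ∈ sphere (0 : E3) 1, ∀ e ∈ I, ∀ t, (e, t) ∈ T →
      |circKer R M K F x ω e t - circKer R M K F x ω e e| ≤ C * |t - e| ^ β) :
    ∀ x ∈ X, ∀ ω, ∀ e ∈ I, ∀ t, (e, t) ∈ T →
      |W (x, ω, e) * circKer R M K F x ω e t - W (x, ω, e) * circKer R M K F x ω e e|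
        ≤ BW * C * |t - e| ^ β := by
  intro x hx ω e he t ht
  rw [← mul_sub, abs_mul, mul_assoc]
  by_cases hω : ω ∈ sphere (0 : E3) 1
  · exact mul_le_mul (hBW _) (hC x hx ω hω e he t ht) (abs_nonneg _) hBW0
  · rw [hW0 x ω hω, abs_zero, zero_mul]
    positivity

lemma measurable_mul_circKer (hRm : ∀ w : E3, Measurable fun ω => R ω w)
    (hM : Measurable fun p : ℝ × ℝ => M p.1 p.2) (hK : Measurable K) (hF : Measurable F)
    (hW : Measurable W) :
    Measurable fun q : (E3 × E3) × ℝ × ℝ =>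
      W (q.1.1, q.1.2, q.2.1) * circKer R M K F q.1.1 q.1.2 q.2.1 q.2.2 :=
  (hW.comp (by fun_prop : Measurable fun q : (E3 × E3) × ℝ × ℝ => (q.1.1, q.1.2, q.2.1))).mul
    (measurable_circKer hRm hM hK hF)

lemma abs_mul_circKer_le {BK BF BW : ℝ} (hBK0 : 0 ≤ BK) (hBK : ∀ p, |K p| ≤ BK)
    (hBF : ∀ p, |F p| ≤ BF) (hBW0 : 0 ≤ BW) (hBW : ∀ p, |W p| ≤ BW) (x ω : E3) (e t : ℝ) :
    |W (x, ω, e) * circKer R M K F x ω e t| ≤ BW * (BK * (BF * (2 * π))) := by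
  rw [abs_mul]
  exact mul_le_mul (hBW _) (abs_circKer_le hBK0 hBK hBF _ _ _ _) (abs_nonneg _) hBW0

lemma ae_nuS_ae_Icc {a b : ℝ} {p : E3 → ℝ → Prop}
    (h : ∀ ω ∈ sphere (0 : E3) 1, ∀ e ∈ Icc a b, p ω e) :
    ∀ᵐ ω ∂nuS, ∀ᵐ e ∂(volume.restrict (Icc a b)), p ω e := by
  filter_upwards [ae_mem_sphere_nuS] with ω hω
  filter_upwards [ae_restrict_mem measurableSet_Icc] with e he
  exact h ω hω e he

lemma integral_nuS_Icc_congr {a b : ℝ} {f g : E3 → ℝ → ℝ}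
    (h : ∀ ω ∈ sphere (0 : E3) 1, ∀ e ∈ Icc a b, f ω e = g ω e) :
    ∫ ω, (∫ e in Icc a b, f ω e) ∂nuS = ∫ ω, (∫ e in Icc a b, g ω e) ∂nuS :=
  integral_congr_ae ((ae_nuS_ae_Icc h).mono fun _ hω => integral_congr_ae hω)

end pairing

lemma measurable_mu : Measurable fun p : ℝ × ℝ => mu p.1 p.2 := by
  unfold mu
  fun_prop

lemma gam_eq_circ (R : E3 → (E3 ≃ₗᵢ[ℝ] E3)) (E' E : ℝ) (ω : E3) (s : ℝ) :
    gam R E' E ω s = R ω (circ (Real.sqrt (1 - mu E' E ^ 2)) (mu E' E) s) := rfl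

lemma gam_mem_sphere (R : E3 → (E3 ≃ₗᵢ[ℝ] E3)) {E' E : ℝ} (hE : 0 < E) (hEE' : E ≤ E') (ω : E3)
    (s : ℝ) : gam R E' E ω s ∈ sphere (0 : E3) 1 := by
  rw [gam_eq_circ, mem_sphere_zero_iff_norm, (R ω).norm_map,
    norm_circ (sqrt_sq_add_sq (mu_nonneg _ _) (mu_le_one hE hEE'))]

/-- the first-order Hadamard operator
`(A₁ψ)(x,ω,E) = p.f.∫_E^{E_m} σ̂₁(x,E',E)(∫_0^{2π} ψ(x,γ(E',E,ω)(s),E') ds)/(E'−E) dE'`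
and its formal adjoint
`(A₁*v)(x,ω',E') = p.f.∫_{E₀}^{E'} σ̂₁(x,E',E)(∫_0^{2π} v(x,γ(E',E,ω')(s),E) ds)/(E'−E) dE`
exist, the pairings are integrable, and `⟨A₁ψ, v⟩_{L²(G×S×I)} = ⟨ψ, A₁*v⟩_{L²(G×S×I)}`. -/
theorem stmt16 (G : Set E3) (hGopen : IsOpen G) (hGbdd : Bornology.IsBounded G)
    (E₀ Em α : ℝ) (hE₀ : 0 < E₀) (hI : E₀ < Em) (hα : 0 < α)
    (σ₁ : E3 → ℝ → ℝ → ℝ) (Cσ : ℝ)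
    (hσc : ContinuousOn (fun p : E3 × ℝ × ℝ => σ₁ p.1 p.2.1 p.2.2)
      (closure G ×ˢ Set.Icc E₀ Em ×ˢ Set.Icc E₀ Em))
    (hσH : ∀ x ∈ closure G, ∀ E₁' ∈ Set.Icc E₀ Em, ∀ E₁ ∈ Set.Icc E₀ Em,
      ∀ E₂' ∈ Set.Icc E₀ Em, ∀ E₂ ∈ Set.Icc E₀ Em,
      |σ₁ x E₁' E₁ - σ₁ x E₂' E₂| ≤ Cσ * (|E₁' - E₂'| ^ α + |E₁ - E₂| ^ α))
    (ψ v : E3 → E3 → ℝ → ℝ) (Cψ Cv : ℝ)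
    (hψc : ContinuousOn (fun p : E3 × E3 × ℝ => ψ p.1 p.2.1 p.2.2)
      (closure G ×ˢ sphere (0 : E3) 1 ×ˢ Set.Icc E₀ Em))
    (hψH : ∀ x ∈ closure G, ∀ ω₁ ∈ sphere (0 : E3) 1, ∀ E₁ ∈ Set.Icc E₀ Em,
      ∀ ω₂ ∈ sphere (0 : E3) 1, ∀ E₂ ∈ Set.Icc E₀ Em,
      |ψ x ω₁ E₁ - ψ x ω₂ E₂| ≤ Cψ * (‖ω₁ - ω₂‖ + |E₁ - E₂|) ^ α)
    (hvc : ContinuousOn (fun p : E3 × E3 × ℝ => v p.1 p.2.1 p.2.2)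
      (closure G ×ˢ sphere (0 : E3) 1 ×ˢ Set.Icc E₀ Em))
    (hvH : ∀ x ∈ closure G, ∀ ω₁ ∈ sphere (0 : E3) 1, ∀ E₁ ∈ Set.Icc E₀ Em,
      ∀ ω₂ ∈ sphere (0 : E3) 1, ∀ E₂ ∈ Set.Icc E₀ Em,
      |v x ω₁ E₁ - v x ω₂ E₂| ≤ Cv * (‖ω₁ - ω₂‖ + |E₁ - E₂|) ^ α)
    (R : E3 → (E3 ≃ₗᵢ[ℝ] E3)) (hR : ∀ ω : E3, ‖ω‖ = 1 → R ω e₃ = ω)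
    (hRm : ∀ w : E3, Measurable fun ω => R ω w) :
    ∃ A₁ψ A₁v : E3 → E3 → ℝ → ℝ,
      (∀ x ∈ closure G, ∀ ω ∈ sphere (0 : E3) 1, ∀ E ∈ Set.Ico E₀ Em,
        HasPF1Upper
          (fun E' => σ₁ x E' E * ∫ s in (0:ℝ)..(2 * π), ψ x (gam R E' E ω s) E')
          E Em (A₁ψ x ω E)) ∧
      (∀ x ∈ closure G, ∀ ω' ∈ sphere (0 : E3) 1, ∀ E' ∈ Set.Ioc E₀ Em,
        HasPF1Lower
          (fun E => σ₁ x E' E * ∫ s in (0:ℝ)..(2 * π), v x (gam R E' E ω' s) E)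
          E₀ E' (A₁v x ω' E')) ∧
      IntegrableOn (fun x => ∫ ω, (∫ E in Set.Icc E₀ Em, |A₁ψ x ω E * v x ω E|) ∂nuS) G ∧
      IntegrableOn (fun x => ∫ ω, (∫ E in Set.Icc E₀ Em, |ψ x ω E * A₁v x ω E|) ∂nuS) G ∧
      ∫ x in G, (∫ ω, (∫ E in Set.Icc E₀ Em, A₁ψ x ω E * v x ω E) ∂nuS)
        = ∫ x in G, (∫ ω, (∫ E in Set.Icc E₀ Em, ψ x ω E * A₁v x ω E) ∂nuS) := by
  have hD : IsCompact (closure G) := hGbdd.isCompact_closure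
  have hprod : IsCompact (closure G ×ˢ sphere (0 : E3) 1 ×ˢ Icc E₀ Em) :=
    hD.prod ((isCompact_sphere 0 1).prod isCompact_Icc)
  obtain ⟨σ', Bσ, hσ'm, hBσ0, hBσ, hσ'eq, -⟩ :=
    exists_measurable_bounded_extension (hD.prod (isCompact_Icc.prod isCompact_Icc)) hσc
  obtain ⟨ψ', Bψ, hψ'm, hBψ0, hBψ, hψ'eq, hψ'0⟩ := exists_measurable_bounded_extension hprod hψc
  obtain ⟨v', Bv, hv'm, hBv0, hBv, hv'eq, hv'0⟩ := exists_measurable_bounded_extension hprod hvc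
  replace hσ'eq : ∀ x ∈ closure G, ∀ e ∈ Icc E₀ Em, ∀ t ∈ Icc E₀ Em, σ' (x, e, t) = σ₁ x e t :=
    fun x hx e he t ht => hσ'eq _ ⟨hx, he, ht⟩
  replace hψ'eq : ∀ x ∈ closure G, ∀ ω ∈ sphere (0 : E3) 1, ∀ e ∈ Icc E₀ Em,
      ψ' (x, ω, e) = ψ x ω e := fun x hx ω hω e he => hψ'eq _ ⟨hx, hω, he⟩
  replace hv'eq : ∀ x ∈ closure G, ∀ ω ∈ sphere (0 : E3) 1, ∀ e ∈ Icc E₀ Em,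
      v' (x, ω, e) = v x ω e := fun x hx ω hω e he => hv'eq _ ⟨hx, hω, he⟩
  replace hψ'0 : ∀ x, ∀ ω ∉ sphere (0 : E3) 1, ∀ e, ψ' (x, ω, e) = 0 :=
    fun x ω hω e => hψ'0 _ fun h => hω h.2.1
  replace hv'0 : ∀ x, ∀ ω ∉ sphere (0 : E3) 1, ∀ e, v' (x, ω, e) = 0 :=
    fun x ω hω e => hv'0 _ fun h => hω h.2.1
  set KA : E3 × ℝ × ℝ → ℝ := fun p => σ' (p.1, p.2.2, p.2.1) with hKA
  set MA : ℝ → ℝ → ℝ := fun e t => mu t e with hMA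
  have hKAm : Measurable KA := hσ'm.comp (by fun_prop)
  have hKAb : ∀ p, |KA p| ≤ Bσ := fun p => hBσ _
  have hMAm : Measurable fun p : ℝ × ℝ => MA p.1 p.2 := measurable_mu.comp measurable_swap
  have hfamU := isSectionFamily_upperTri hI
  have hfamL := isSectionFamily_lowerTri hI
  have hpos : ∀ e ∈ Icc E₀ Em, 0 < e := fun e he => hE₀.trans_le he.1
  have hα2 : 0 < α / 2 := half_pos hα
  obtain ⟨CA, hCA0, hCA⟩ := exists_holder_circKer (X := closure G) (R := R) (M := MA) (K := KA)
    (F := ψ') (CK := Cσ) (CF := Cψ) hR hI hα (Real.sqrt_nonneg (2 / E₀)) hfamU.subset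
    (fun e he t ht => ⟨mu_nonneg _ _, mu_le_one (hpos e he) ht.2.1.le, fun s => by
      rw [abs_of_pos (sub_pos.mpr ht.2.1)]
      exact norm_circ_mu_sub_e₃_le hE₀ he.1 ht.2.1.le s⟩)
    (fun e he => mu_self (hpos e he)) hBσ0 hKAb hBψ0 hψ'm hBψ
    (fun x hx e he t ht => by
      simp only [hKA]
      rw [hσ'eq x hx t ht e he, hσ'eq x hx e he e he]
      simpa [Real.zero_rpow hα.ne'] using hσH x hx t ht e he e he e he)
    (fun x hx ω₁ h₁ E₁ hE₁ ω₂ h₂ E₂ hE₂ => by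
      rw [hψ'eq x hx ω₁ h₁ E₁ hE₁, hψ'eq x hx ω₂ h₂ E₂ hE₂]
      exact hψH x hx ω₁ h₁ E₁ hE₁ ω₂ h₂ E₂ hE₂)
  obtain ⟨CB, hCB0, hCB⟩ := exists_holder_circKer (X := closure G) (R := R) (M := mu) (K := σ')
    (F := v') (CK := Cσ) (CF := Cv) hR hI hα (Real.sqrt_nonneg (2 / E₀)) hfamL.subset
    (fun e he t ht => ⟨mu_nonneg _ _, mu_le_one (hE₀.trans_le ht.1) ht.2.1.le, fun s => by
      rw [abs_sub_comm, abs_of_pos (sub_pos.mpr ht.2.1)]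
      exact norm_circ_mu_sub_e₃_le hE₀ ht.1 ht.2.1.le s⟩)
    (fun e he => mu_self (hpos e he)) hBσ0 hBσ hBv0 hv'm hBv
    (fun x hx e he t ht => by
      rw [hσ'eq x hx e he t ht, hσ'eq x hx e he e he]
      simpa [Real.zero_rpow hα.ne'] using hσH x hx e he t ht e he e he)
    (fun x hx ω₁ h₁ E₁ hE₁ ω₂ h₂ E₂ hE₂ => by
      rw [hv'eq x hx ω₁ h₁ E₁ hE₁, hv'eq x hx ω₂ h₂ E₂ hE₂]
      exact hvH x hx ω₁ h₁ E₁ hE₁ ω₂ h₂ E₂ hE₂)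
  have hAm := measurable_circKer hRm hMAm hKAm hψ'm
  have hBm := measurable_circKer hRm measurable_mu hσ'm hv'm
  have hPm := measurable_mul_circKer hRm hMAm hKAm hψ'm hv'm
  have hQm := measurable_mul_circKer hRm measurable_mu hσ'm hv'm hψ'm
  have hPb := abs_mul_circKer_le (R := R) (M := MA) hBσ0 hKAb hBψ hBv0 hBv
  have hQb := abs_mul_circKer_le (R := R) (M := mu) hBσ0 hBσ hBv hBψ0 hBψ
  have hPH := holder_mul_circKer hBv0 hBv hv'0 hCA0 hCA
  have hQH := holder_mul_circKer hBψ0 hBψ hψ'0 hCB0 hCB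
  have hGcl : ∀ x ∈ G, x ∈ closure G := fun x hx => subset_closure hx
  set A₁ψ : E3 → E3 → ℝ → ℝ := fun x ω e =>
    pfOp (upperTri E₀ Em) (fun e => Em - e) 0 (circKer R MA KA ψ' x ω e) e with hA₁ψ
  set A₁v : E3 → E3 → ℝ → ℝ := fun x ω e =>
    pfOp (lowerTri E₀ Em) (fun e => e - E₀) 0 (circKer R mu σ' v' x ω e) e with hA₁v
  have hA₁ψv : ∀ x ∈ G, ∀ ω ∈ sphere (0 : E3) 1, ∀ e ∈ Icc E₀ Em, A₁ψ x ω e * v x ω e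
      = pfOp (upperTri E₀ Em) (fun e => Em - e) 0
        (fun t => v' (x, ω, e) * circKer R MA KA ψ' x ω e t) e := fun x hx ω hω e he => by
    rw [pfOp_const_mul, hv'eq x (hGcl x hx) ω hω e he, mul_comm]
  have hψA₁v : ∀ x ∈ G, ∀ ω ∈ sphere (0 : E3) 1, ∀ e ∈ Icc E₀ Em, ψ x ω e * A₁v x ω e
      = pfOp (lowerTri E₀ Em) (fun e => e - E₀) 0
        (fun t => ψ' (x, ω, e) * circKer R mu σ' v' x ω e t) e := fun x hx ω hω e he => by
    rw [pfOp_const_mul, hψ'eq x (hGcl x hx) ω hω e he]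
  refine ⟨A₁ψ, A₁v, fun x hx ω hω e he => ?_, fun x hx ω hω e he => ?_, ?_, ?_, ?_⟩
  · refine hasPF1Upper_pfOp hα2 he hCA0 (hAm.comp (by fun_prop :
      Measurable fun t : ℝ => ((x, ω), e, t))) (hCA x hx ω hω e (Ico_subset_Icc_self he))
      fun t ht => ?_
    have htI : t ∈ Icc E₀ Em := ⟨he.1.trans ht.1, ht.2⟩
    simp only [circKer, hKA, hσ'eq x hx t htI e (Ico_subset_Icc_self he)]
    congr 1
    refine intervalIntegral.integral_congr fun s _ => ?_
    exact (hψ'eq x hx _ (gam_mem_sphere R (hE₀.trans_le he.1) ht.1 ω s) t htI).symm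
  · refine hasPF1Lower_pfOp hα2 he hCB0 (hBm.comp (by fun_prop :
      Measurable fun t : ℝ => ((x, ω), e, t))) (hCB x hx ω hω e (Ioc_subset_Icc_self he))
      fun t ht => ?_
    have htI : t ∈ Icc E₀ Em := ⟨ht.1, ht.2.trans he.2⟩
    simp only [circKer, hσ'eq x hx e (Ioc_subset_Icc_self he) t htI]
    congr 1
    refine intervalIntegral.integral_congr fun s _ => ?_
    exact (hv'eq x hx _ (gam_mem_sphere R (hE₀.trans_le ht.1) ht.2 ω s) t htI).symm
  · refine (hfamU.integrableOn_integral_abs_pfOp (ν := nuS) hGopen.measurableSet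
      hGbdd.measure_lt_top.ne hα2 hPm (mul_nonneg hBv0 hCA0) hPb
      fun x hx => hPH x (hGcl x hx)).congr_fun
      (fun x hx => integral_nuS_Icc_congr fun ω hω e he => ?_) hGopen.measurableSet
    rw [hA₁ψv x hx ω hω e he]
  · refine (hfamL.integrableOn_integral_abs_pfOp (ν := nuS) hGopen.measurableSet
      hGbdd.measure_lt_top.ne hα2 hQm (mul_nonneg hBψ0 hCB0) hQb
      fun x hx => hQH x (hGcl x hx)).congr_fun
      (fun x hx => integral_nuS_Icc_congr fun ω hω e he => ?_) hGopen.measurableSet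
    rw [hψA₁v x hx ω hω e he]
  · refine setIntegral_congr_fun hGopen.measurableSet fun x hx => ?_
    have hx' := hGcl x hx
    have hslice : Measurable fun q : E3 × ℝ × ℝ => ((x, q.1), q.2.1, q.2.2) := by fun_prop
    have hPQ : ∀ e ∈ Icc E₀ Em, ∀ t, e ≤ t →
        ∫ ω, v' (x, ω, e) * circKer R MA KA ψ' x ω e t ∂nuS
          = ∫ ω, ψ' (x, ω, t) * circKer R mu σ' v' x ω t e ∂nuS := fun e he t het =>
      integral_mul_circKer_comm hR hRm hψ'm hv'm hBψ hBv rfl (mu_nonneg _ _)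
        (mu_le_one (hpos e he) het) rfl
    have hP1 := hfamU.integrable_pfOp nuS hα2 (hPm.comp hslice) (mul_nonneg hBv0 hCA0) (hPb x)
      (hPH x hx')
    have hQ1 := hfamL.integrable_pfOp nuS hα2 (hQm.comp hslice) (mul_nonneg hBψ0 hCB0) (hQb x)
      (hQH x hx')
    have hswap := hfamU.integral_pfOp_eq_swap nuS hfamL (fun e t => Iff.rfl) hα2
      (hPm.comp hslice) (hQm.comp hslice) (mul_nonneg hBv0 hCA0) (hPb x) (mul_nonneg hBψ0 hCB0)
      (hQb x) (hPH x hx') (hQH x hx') (fun e he t ht => hPQ e he t ht.2.1.le)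
      (fun e he => hPQ e he e le_rfl)
    rw [integral_prod _ hP1, integral_prod _ hQ1] at hswap
    exact (integral_nuS_Icc_congr (hA₁ψv x hx)).trans
      (hswap.trans (integral_nuS_Icc_congr (hψA₁v x hx)).symm)
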